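/- Let u ∈ W^{(n−1)/n,n}(Ω;ℝ^n) and ψ ∈ C^1_c(Ω). If (u_k) and (v_k) are any two sequences of maps, each continuously differentiable up to the boundary of Ω with values in ℝ^n, such that ‖u_k − u‖_{W^{(n−1)/n,n}(Ω)} → 0 and ‖v_k − u‖_{W^{(n−1)/n,n}(Ω)} → 0, then the limits lim_k ∫_Ω det∇u_k(x) ψ(x) dx and lim_k ∫_Ω det∇v_k(x) ψ(x) dx both exist in ℝ and are equal. (Hence the distributional Jacobian ⟨Ju,ψ⟩ is well defined as this common limit.) -/

import Mathlib

open MeasureTheory Metric Filter Topology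

noncomputable section

abbrev Euc (n : ℕ) := EuclideanSpace ℝ (Fin n)

/-- The Jacobian matrix `∇u(x)` of a map `u : ℝⁿ → ℝⁿ`, with entries `∂_j u_i (x)`. -/
def jacMat (n : ℕ) (u : Euc n → Euc n) (x : Euc n) : Matrix (Fin n) (Fin n) ℝ :=
  Matrix.of fun i j => fderiv ℝ u x (EuclideanSpace.single j 1) i

/-- The vector field `j u := (1/n) (cof ∇u)ᵀ u` (componentwise); note that
`(cof A)ᵀ = adjugate A`. -/
def jvec (n : ℕ) (u : Euc n → Euc n) (x : Euc n) : Fin n → ℝ :=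
  fun i => (n : ℝ)⁻¹ * Matrix.mulVec (Matrix.adjugate (jacMat n u x)) (fun j => u x j) i

/-- The pointwise pairing `j u (x) · ∇ψ(x)`. -/
def jPair (n : ℕ) (u : Euc n → Euc n) (ψ : Euc n → ℝ) (x : Euc n) : ℝ :=
  ∑ i, jvec n u x i * fderiv ℝ ψ x (EuclideanSpace.single i 1)

/-- `ψ ∈ C¹_c(Ω)`. -/
def Cc1 (n : ℕ) (Ω : Set (Euc n)) (ψ : Euc n → ℝ) : Prop :=
  ContDiff ℝ 1 ψ ∧ HasCompactSupport ψ ∧ tsupport ψ ⊆ Ω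

/-- The fractional Sobolev seminorm `[u]_{W^{s,p}(Ω)}`. -/
def sobSemi (n : ℕ) (s p : ℝ) (Ω : Set (Euc n)) {F : Type*} [NormedAddCommGroup F]
    (u : Euc n → F) : ℝ :=
  (∫ x in Ω, ∫ y in Ω, ‖u x - u y‖ ^ p / dist x y ^ ((n : ℝ) + s * p)) ^ (1 / p)

/-- The fractional Sobolev norm `‖u‖_{W^{s,p}(Ω)} = ‖u‖_{L^p(Ω)} + [u]_{W^{s,p}(Ω)}`. -/
def sobNorm (n : ℕ) (s p : ℝ) (Ω : Set (Euc n)) {F : Type*} [NormedAddCommGroup F]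
    (u : Euc n → F) : ℝ :=
  (∫ x in Ω, ‖u x‖ ^ p) ^ (1 / p) + sobSemi n s p Ω u

/-- Membership `u ∈ W^{s,p}(Ω; F)`: `u ∈ L^p(Ω)` and the double integral defining
`[u]_{W^{s,p}(Ω)}^p` is finite. -/
def MemWsp (n : ℕ) (s p : ℝ) (Ω : Set (Euc n)) {F : Type*} [NormedAddCommGroup F]
    (u : Euc n → F) : Prop :=
  AEStronglyMeasurable u (volume.restrict Ω) ∧
  Integrable (fun x => ‖u x‖ ^ p) (volume.restrict Ω) ∧
  Integrable (fun q : Euc n × Euc n => ‖u q.1 - u q.2‖ ^ p / dist q.1 q.2 ^ ((n : ℝ) + s * p))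
    ((volume.restrict Ω).prod (volume.restrict Ω))

/-- `Ω` has smooth boundary: it is a sublevel set of a smooth function whose
differential does not vanish on the boundary. -/
def SmoothBoundary (n : ℕ) (Ω : Set (Euc n)) : Prop :=
  ∃ f : Euc n → ℝ, ContDiff ℝ (⊤ : ℕ∞) f ∧ Ω = f ⁻¹' Set.Iio 0 ∧
    ∀ x ∈ frontier Ω, fderiv ℝ f x ≠ 0

/-- `u^a(x) = (u(x) - a)/|u(x) - a|`. -/
def proj (n : ℕ) (u : Euc n → Euc n) (a : Euc n) : Euc n → Euc n :=
  fun x => ‖u x - a‖⁻¹ • (u x - a)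

/-- The set of Hölder quotients of `u` on `Ω`. -/
def holderSet (n : ℕ) (α : ℝ) (Ω : Set (Euc n)) {F : Type*} [NormedAddCommGroup F]
    (u : Euc n → F) : Set ℝ :=
  {r | ∃ x ∈ Ω, ∃ y ∈ Ω, x ≠ y ∧ r = ‖u x - u y‖ / dist x y ^ α}

/-- The Hölder seminorm `[u]_{C^{0,α}(Ω)}`. -/
def holderSemi (n : ℕ) (α : ℝ) (Ω : Set (Euc n)) {F : Type*} [NormedAddCommGroup F]
    (u : Euc n → F) : ℝ :=
  sSup (holderSet n α Ω u)

/-- The Hölder norm `‖u‖_{C^{0,α}(Ω)} = sup_Ω ‖u‖ + [u]_{C^{0,α}(Ω)}`. -/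
def holderNorm (n : ℕ) (α : ℝ) (Ω : Set (Euc n)) {F : Type*} [NormedAddCommGroup F]
    (u : Euc n → F) : ℝ :=
  sSup {r | ∃ x ∈ Ω, r = ‖u x‖} + holderSemi n α Ω u

/-- the volume `ω_n` of the unit ball of `ℝⁿ`. -/
def ballVol (n : ℕ) : ℝ := (volume (ball (0 : Euc n) 1)).toReal

/-- `⟨Jv, ψ⟩ = J` for `v ∈ W^{(n-1)/n, n}(Ω; ℝⁿ)`: approximating sequences of maps which are
`C¹` up to the boundary exist, and for every such sequence the Jacobian integrals converge
to `J`. -/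
def JPairing (n : ℕ) (Ω : Set (Euc n)) (v : Euc n → Euc n) (ψ : Euc n → ℝ) (J : ℝ) : Prop :=
  (∃ vk : ℕ → Euc n → Euc n, (∀ k, ContDiffOn ℝ 1 (vk k) (closure Ω)) ∧
      Tendsto (fun k => sobNorm n (((n : ℝ) - 1) / n) n Ω (vk k - v)) atTop (𝓝 0) ∧
      Tendsto (fun k => ∫ x in Ω, (jacMat n (vk k) x).det * ψ x) atTop (𝓝 J)) ∧
  (∀ vk : ℕ → Euc n → Euc n, (∀ k, ContDiffOn ℝ 1 (vk k) (closure Ω)) →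
      Tendsto (fun k => sobNorm n (((n : ℝ) - 1) / n) n Ω (vk k - v)) atTop (𝓝 0) →
      Tendsto (fun k => ∫ x in Ω, (jacMat n (vk k) x).det * ψ x) atTop (𝓝 J))

/-- The set of values `⟨Jv, ψ⟩` over test functions `ψ ∈ C¹_c(Ω)` with `|ψ| ≤ 1`;
its supremum is the total variation `|Jv|_{TV}`. -/
def TVset (n : ℕ) (Ω : Set (Euc n)) (v : Euc n → Euc n) : Set ℝ :=
  {r | ∃ ψ : Euc n → ℝ, Cc1 n Ω ψ ∧ (∀ x, |ψ x| ≤ 1) ∧ JPairing n Ω v ψ r}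

/-- `⟨Jv, ψ⟩ = -∫_Ω j v · ∇ψ` for (pointwise defined) `v`. -/
def jpairOn (n : ℕ) (Ω : Set (Euc n)) (v : Euc n → Euc n) (ψ : Euc n → ℝ) : ℝ :=
  -∫ x in Ω, jPair n v ψ x

/-- The `W^{-1,1}(Ω)` distance between two functionals on test functions:
`sup { S ψ - T ψ : ψ ∈ C¹_c(Ω), Lip ψ ≤ 1 }`. -/
def Wm11dist (n : ℕ) (Ω : Set (Euc n)) (S T : (Euc n → ℝ) → ℝ) : ℝ :=
  sSup {r | ∃ ψ : Euc n → ℝ, Cc1 n Ω ψ ∧ LipschitzWith 1 ψ ∧ r = S ψ - T ψ}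

open MeasureTheory Metric Filter Topology
noncomputable section

/-- standard basis vector -/
def bv (n : ℕ) (j : Fin n) : Euc n := EuclideanSpace.single j (1 : ℝ)

/-- Jacobian determinant of a family of scalar functions -/
def DJ (n : ℕ) (f : Fin n → Euc n → ℝ) (x : Euc n) : ℝ :=
  Matrix.det (Matrix.of fun i j => fderiv ℝ (f i) x (bv n j))

lemma DJ_eq (n : ℕ) (f : Fin n → Euc n → ℝ) (x : Euc n) :
    DJ n f x = ∑ σ : Equiv.Perm (Fin n), ((Equiv.Perm.sign σ : ℤ) : ℝ) *
      ∏ i, fderiv ℝ (f i) x (bv n (σ i)) := by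
  unfold DJ
  rw [← Matrix.det_transpose, Matrix.det_apply']
  rfl

lemma DJ_update_eq (n : ℕ) (c : Fin n → Euc n → ℝ) (m : Fin n) (g : Euc n → ℝ) (x : Euc n) :
    DJ n (Function.update c m g) x = ∑ σ : Equiv.Perm (Fin n), ((Equiv.Perm.sign σ : ℤ) : ℝ) *
      (fderiv ℝ g x (bv n (σ m)) *
        ∏ i ∈ Finset.univ.erase m, fderiv ℝ (c i) x (bv n (σ i))) := by
  rw [DJ_eq]
  refine Finset.sum_congr rfl fun σ _ => ?_
  rw [← Finset.mul_prod_erase Finset.univ _ (Finset.mem_univ m)]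
  congr 2
  · simp
  · refine Finset.prod_congr rfl fun i hi => ?_
    rw [Function.update_of_ne (Finset.ne_of_mem_erase hi)]

lemma cont_fderiv_apply {n : ℕ} {f : Euc n → ℝ} (hf : ContDiff ℝ 1 f) (v : Euc n) :
    Continuous fun x => fderiv ℝ f x v :=
  (hf.continuous_fderiv (by norm_num)).clm_apply continuous_const

lemma diff_fderiv_apply {n : ℕ} {f : Euc n → ℝ} (hf : ContDiff ℝ 2 f) (v : Euc n) :
    ContDiff ℝ 1 fun x => fderiv ℝ f x v :=
  (hf.fderiv_right (m := 1) (by norm_num)).clm_apply contDiff_const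

lemma hcs_fderiv_apply {n : ℕ} {f : Euc n → ℝ} (hf : HasCompactSupport f) (v : Euc n) :
    HasCompactSupport fun x => fderiv ℝ f x v :=
  hf.fderiv_apply (𝕜 := ℝ) v

lemma piola (n : ℕ) (c : Fin n → Euc n → ℝ) (hc : ∀ i, ContDiff ℝ 2 (c i)) (m : Fin n)
    (x : Euc n) :
    ∑ σ : Equiv.Perm (Fin n), ((Equiv.Perm.sign σ : ℤ) : ℝ) *
      fderiv ℝ (fun y => ∏ i ∈ Finset.univ.erase m, fderiv ℝ (c i) y (bv n (σ i))) x
        (bv n (σ m)) = 0 := by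
  have h1 : ∀ σ : Equiv.Perm (Fin n),
      fderiv ℝ (fun y => ∏ i ∈ Finset.univ.erase m, fderiv ℝ (c i) y (bv n (σ i))) x
        (bv n (σ m)) = ∑ k ∈ Finset.univ.erase m,
          (∏ i ∈ (Finset.univ.erase m).erase k, fderiv ℝ (c i) x (bv n (σ i))) *
            fderiv ℝ (fderiv ℝ (c k)) x (bv n (σ m)) (bv n (σ k)) := by
    intro σ
    have := HasFDerivAt.finsetProd (𝕜 := ℝ) (u := Finset.univ.erase m) (x := x)
      (g := fun i y => fderiv ℝ (c i) y (bv n (σ i)))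
      (g' := fun i => fderiv ℝ (fun y => fderiv ℝ (c i) y (bv n (σ i))) x)
      (fun i _ => ((diff_fderiv_apply (hc i) _).differentiable (by norm_num) x).hasFDerivAt)
    rw [this.fderiv]
    simp only [_root_.sum_apply, _root_.smul_apply, smul_eq_mul]
    refine Finset.sum_congr rfl fun k _ => ?_
    congr 1
    have hd : DifferentiableAt ℝ (fderiv ℝ (c k)) x :=
      ((hc k).fderiv_right (m := 1) (by norm_num)).differentiable (by norm_num) x
    rw [fderiv_clm_apply hd (differentiableAt_const _)]
    simp
  simp_rw [h1, Finset.mul_sum]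
  rw [Finset.sum_comm]
  refine Finset.sum_eq_zero fun k hk => ?_
  have hkm : k ≠ m := Finset.ne_of_mem_erase hk
  set F : Equiv.Perm (Fin n) → ℝ := fun σ => ((Equiv.Perm.sign σ : ℤ) : ℝ) *
    ((∏ i ∈ (Finset.univ.erase m).erase k, fderiv ℝ (c i) x (bv n (σ i))) *
            fderiv ℝ (fderiv ℝ (c k)) x (bv n (σ m)) (bv n (σ k))) with hF
  have h2 : ∀ σ, F (σ * Equiv.swap m k) = - F σ := by
    intro σ
    simp only [hF]
    have hs : fderiv ℝ (fderiv ℝ (c k)) x (bv n (σ k)) (bv n (σ m)) =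
        fderiv ℝ (fderiv ℝ (c k)) x (bv n (σ m)) (bv n (σ k)) := by
      have : IsSymmSndFDerivAt ℝ (c k) x :=
        (hc k).contDiffAt.isSymmSndFDerivAt (by simp)
      exact this _ _
    have hp : ∏ i ∈ (Finset.univ.erase m).erase k,
          fderiv ℝ (c i) x (bv n ((σ * Equiv.swap m k) i)) =
        ∏ i ∈ (Finset.univ.erase m).erase k, fderiv ℝ (c i) x (bv n (σ i)) := by
      refine Finset.prod_congr rfl fun i hi => ?_
      have h1 : i ≠ k := Finset.ne_of_mem_erase hi
      have h2 : i ≠ m := Finset.ne_of_mem_erase (Finset.mem_of_mem_erase hi)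
      rw [Equiv.Perm.mul_apply, Equiv.swap_apply_of_ne_of_ne h2 h1]
    rw [hp]
    simp only [Equiv.Perm.mul_apply, Equiv.swap_apply_left, Equiv.swap_apply_right, hs,
      Equiv.Perm.sign_mul, Equiv.Perm.sign_swap hkm.symm]
    push_cast
    ring
  have h3 : ∑ σ, F σ = ∑ σ, F (σ * Equiv.swap m k) :=
    (Equiv.sum_comp (Equiv.mulRight (Equiv.swap m k)) F).symm
  simp_rw [h2, Finset.sum_neg_distrib] at h3
  change ∑ σ, F σ = 0
  linarith

lemma integral_DJ_zero (n : ℕ) (c : Fin n → Euc n → ℝ) (hc : ∀ i, ContDiff ℝ 2 (c i)) (m : Fin n)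
    (g : Euc n → ℝ) (hg : ContDiff ℝ 1 g) (hgs : HasCompactSupport g) :
    ∫ x, DJ n (Function.update c m g) x = 0 := by
  simp_rw [DJ_update_eq]
  set P : Equiv.Perm (Fin n) → Euc n → ℝ :=
    fun σ x => ∏ i ∈ Finset.univ.erase m, fderiv ℝ (c i) x (bv n (σ i)) with hP
  have hPc : ∀ σ, ContDiff ℝ 1 (P σ) := fun σ =>
    contDiff_prod fun i _ => diff_fderiv_apply (hc i) _
  have i1 : ∀ σ, Integrable fun x => fderiv ℝ g x (bv n (σ m)) * P σ x := fun σ =>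
    ((cont_fderiv_apply hg _).mul (hPc σ).continuous).integrable_of_hasCompactSupport
      ((hcs_fderiv_apply hgs _).mul_right)
  have i2 : ∀ σ : Equiv.Perm (Fin n), Integrable fun x => g x * fderiv ℝ (P σ) x (bv n (σ m)) :=
    fun σ => (hg.continuous.mul (cont_fderiv_apply (hPc σ) _)).integrable_of_hasCompactSupport
      (hgs.mul_right)
  have i3 : ∀ σ, Integrable fun x => g x * P σ x :=
    fun σ => (hg.continuous.mul (hPc σ).continuous).integrable_of_hasCompactSupport
      (hgs.mul_right)
  have key : ∀ σ : Equiv.Perm (Fin n), ∫ x, fderiv ℝ g x (bv n (σ m)) * P σ x =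
      - ∫ x, g x * fderiv ℝ (P σ) x (bv n (σ m)) := by
    intro σ
    rw [integral_mul_fderiv_eq_neg_fderiv_mul_of_integrable (i1 σ) (i2 σ) (i3 σ)
      (fun x _ => hg.differentiable (by norm_num) x)
      (fun x _ => (hPc σ).differentiable (by norm_num) x)]
    simp
  rw [integral_finsetSum _ (fun σ _ => (i1 σ).const_mul _)]
  simp_rw [integral_const_mul]
  change ∑ σ : Equiv.Perm (Fin n), ((Equiv.Perm.sign σ : ℤ) : ℝ) *
    ∫ x, fderiv ℝ g x (bv n (σ m)) * P σ x = 0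
  simp_rw [key, ← integral_neg, ← integral_const_mul]
  have i4 : ∀ σ : Equiv.Perm (Fin n),
      Integrable fun x => -(g x * fderiv ℝ (P σ) x (bv n (σ m))) := fun σ => (i2 σ).neg
  rw [← integral_finsetSum _ (fun σ _ => (i4 σ).const_mul _)]
  rw [← integral_zero (Euc n) ℝ]
  congr 1
  funext x
  have := piola n c hc m x
  calc _ = - g x * ∑ σ : Equiv.Perm (Fin n), ((Equiv.Perm.sign σ : ℤ) : ℝ) *
        fderiv ℝ (P σ) x (bv n (σ m)) := by
        rw [Finset.mul_sum]
        refine Finset.sum_congr rfl fun σ _ => ?_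
        ring
    _ = 0 := by rw [this, mul_zero]

lemma DJ_update_sub (n : ℕ) (c : Fin n → Euc n → ℝ) (m : Fin n) (p q : Euc n → ℝ) (x : Euc n)
    (hp : DifferentiableAt ℝ p x) (hq : DifferentiableAt ℝ q x) :
    DJ n (Function.update c m p) x - DJ n (Function.update c m q) x =
      DJ n (Function.update c m (fun y => p y - q y)) x := by
  rw [DJ_update_eq, DJ_update_eq, DJ_update_eq, ← Finset.sum_sub_distrib]
  refine Finset.sum_congr rfl fun σ _ => ?_
  rw [fderiv_fun_sub hp hq, _root_.sub_apply]
  ring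

lemma DJ_update_mul (n : ℕ) (c : Fin n → Euc n → ℝ) (m : Fin n) (p q : Euc n → ℝ) (x : Euc n)
    (hp : DifferentiableAt ℝ p x) (hq : DifferentiableAt ℝ q x) :
    DJ n (Function.update c m (fun y => p y * q y)) x =
      DJ n (Function.update c m p) x * q x + p x * DJ n (Function.update c m q) x := by
  rw [DJ_update_eq, DJ_update_eq, DJ_update_eq, Finset.sum_mul, Finset.mul_sum,
    ← Finset.sum_add_distrib]
  refine Finset.sum_congr rfl fun σ _ => ?_
  rw [fderiv_fun_mul hp hq]
  simp only [_root_.add_apply, _root_.smul_apply, smul_eq_mul]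
  ring

lemma cont_DJ (n : ℕ) (c : Fin n → Euc n → ℝ) (hc : ∀ i, ContDiff ℝ 1 (c i)) :
    Continuous (DJ n c) := by
  have : DJ n c = fun x => ∑ σ : Equiv.Perm (Fin n), ((Equiv.Perm.sign σ : ℤ) : ℝ) *
      ∏ i, fderiv ℝ (c i) x (bv n (σ i)) := funext fun x => DJ_eq n c x
  rw [this]
  exact continuous_finsetSum _ fun σ _ => continuous_const.mul
    (continuous_finsetProd _ fun i _ => cont_fderiv_apply (hc i) _)

lemma DJ_update_psi_bound (n : ℕ) (c : Fin n → Euc n → ℝ) (m : Fin n) (ψ : Euc n → ℝ) (x : Euc n)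
    (B β : ℝ) (hB : ∀ j, |fderiv ℝ ψ x (bv n j)| ≤ B)
    (hβ : ∀ i j, |fderiv ℝ (c i) x (bv n j)| ≤ β) :
    |DJ n (Function.update c m ψ) x| ≤ n.factorial * (B * β ^ (n - 1)) := by
  rw [DJ_update_eq]
  refine (Finset.abs_sum_le_sum_abs _ _).trans ?_
  have : ∀ σ ∈ (Finset.univ : Finset (Equiv.Perm (Fin n))), |((Equiv.Perm.sign σ : ℤ) : ℝ) *
      (fderiv ℝ ψ x (bv n (σ m)) *
        ∏ i ∈ Finset.univ.erase m, fderiv ℝ (c i) x (bv n (σ i)))| ≤ B * β ^ (n - 1) := by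
    intro σ _
    have hs : |((Equiv.Perm.sign σ : ℤ) : ℝ)| = 1 := by
      rcases Int.units_eq_one_or (Equiv.Perm.sign σ) with h | h <;> simp [h]
    rw [abs_mul, hs, one_mul, abs_mul, Finset.abs_prod]
    refine mul_le_mul (hB _) ?_ (Finset.prod_nonneg fun _ _ => abs_nonneg _)
      ((abs_nonneg _).trans (hB m))
    refine (Finset.prod_le_prod (fun _ _ => abs_nonneg _) (fun i _ => hβ i (σ i))).trans ?_
    simp [Finset.card_erase_of_mem]
  refine (Finset.sum_le_sum this).trans ?_
  simp [Finset.card_univ, Fintype.card_perm]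

lemma step_bound (n : ℕ) (c : Fin n → Euc n → ℝ) (hc : ∀ i, ContDiff ℝ 2 (c i)) (m : Fin n)
    (w ψ : Euc n → ℝ) (hw : ContDiff ℝ 1 w) (hψ : ContDiff ℝ 1 ψ) (hψs : HasCompactSupport ψ)
    (B : ℝ) (hB : ∀ x j, |fderiv ℝ ψ x (bv n j)| ≤ B)
    (α β G : Euc n → ℝ) (hα : ∀ x ∈ tsupport ψ, |w x| ≤ α x)
    (hβ : ∀ x ∈ tsupport ψ, ∀ i j, |fderiv ℝ (c i) x (bv n j)| ≤ β x)
    (hG : ∀ x ∈ tsupport ψ, α x * β x ^ (n - 1) ≤ G x)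
    (hGi : IntegrableOn G (tsupport ψ)) :
    |∫ x, DJ n (Function.update c m w) x * ψ x| ≤ n.factorial * B * ∫ x in tsupport ψ, G x := by
  have hB0 : 0 ≤ B := (abs_nonneg _).trans (hB 0 m)
  have hup : ∀ g, ContDiff ℝ 1 g → Continuous (DJ n (Function.update c m g)) := by
    intro g hg
    refine cont_DJ n _ fun i => ?_
    by_cases h : i = m
    · subst h; simpa using hg
    · rw [Function.update_of_ne h]; exact (hc i).of_le (by norm_num)
  have i1 : Integrable fun x => DJ n (Function.update c m w) x * ψ x :=
    ((hup w hw).mul hψ.continuous).integrable_of_hasCompactSupport hψs.mul_left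
  have hzero : ∀ x, x ∉ tsupport ψ → DJ n (Function.update c m ψ) x = 0 := by
    intro x hx
    rw [DJ_update_eq]
    refine Finset.sum_eq_zero fun σ _ => ?_
    have : fderiv ℝ ψ x = 0 := by
      by_contra h
      exact hx (support_fderiv_subset ℝ h)
    rw [this]; simp
  have i2 : Integrable fun x => w x * DJ n (Function.update c m ψ) x := by
    refine (hw.continuous.mul (hup ψ hψ)).integrable_of_hasCompactSupport ?_
    refine HasCompactSupport.mul_left ?_
    exact HasCompactSupport.intro hψs hzero
  have h0 := integral_DJ_zero n c hc m (fun x => w x * ψ x) (hw.mul hψ) (hψs.mul_left)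
  have h1 : ∀ x, DJ n (Function.update c m (fun y => w y * ψ y)) x =
      DJ n (Function.update c m w) x * ψ x + w x * DJ n (Function.update c m ψ) x := fun x =>
    DJ_update_mul n c m w ψ x (hw.differentiable (by norm_num) x)
      (hψ.differentiable (by norm_num) x)
  simp_rw [h1] at h0
  rw [integral_add i1 i2] at h0
  have h2 : ∫ x, DJ n (Function.update c m w) x * ψ x =
      - ∫ x, w x * DJ n (Function.update c m ψ) x := by linarith
  rw [h2, abs_neg]
  have h3 : ∫ x, w x * DJ n (Function.update c m ψ) x =
      ∫ x in tsupport ψ, w x * DJ n (Function.update c m ψ) x := by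
    rw [setIntegral_eq_integral_of_forall_compl_eq_zero]
    intro x hx
    rw [hzero x hx, mul_zero]
  rw [h3, ← integral_const_mul]
  refine (abs_integral_le_integral_abs).trans ?_
  refine setIntegral_mono_on i2.abs.integrableOn (hGi.const_mul _)
    (isClosed_tsupport ψ).measurableSet ?_
  intro x hx
  have hw' := hα x hx
  have hd := DJ_update_psi_bound n c m ψ x B (β x) (hB x) (hβ x hx)
  have hα0 : 0 ≤ α x := (abs_nonneg _).trans hw'
  rw [abs_mul]
  calc |w x| * |DJ n (Function.update c m ψ) x| ≤ α x * (n.factorial * (B * β x ^ (n - 1))) :=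
        mul_le_mul hw' hd (abs_nonneg _) hα0
    _ = n.factorial * B * (α x * β x ^ (n - 1)) := by ring
    _ ≤ n.factorial * B * G x := by
        exact mul_le_mul_of_nonneg_left (hG x hx) (by positivity)

lemma diff_bound (n : ℕ) (a b : Fin n → Euc n → ℝ) (ha : ∀ i, ContDiff ℝ 2 (a i))
    (hb : ∀ i, ContDiff ℝ 2 (b i))
    (ψ : Euc n → ℝ) (hψ : ContDiff ℝ 1 ψ) (hψs : HasCompactSupport ψ)
    (B : ℝ) (hB : ∀ x j, |fderiv ℝ ψ x (bv n j)| ≤ B)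
    (α β G : Euc n → ℝ) (hα : ∀ x ∈ tsupport ψ, ∀ i, |a i x - b i x| ≤ α x)
    (hβa : ∀ x ∈ tsupport ψ, ∀ i j, |fderiv ℝ (a i) x (bv n j)| ≤ β x)
    (hβb : ∀ x ∈ tsupport ψ, ∀ i j, |fderiv ℝ (b i) x (bv n j)| ≤ β x)
    (hG : ∀ x ∈ tsupport ψ, α x * β x ^ (n - 1) ≤ G x)
    (hGi : IntegrableOn G (tsupport ψ)) :
    |(∫ x, DJ n a x * ψ x) - ∫ x, DJ n b x * ψ x| ≤
      n * (n.factorial * B * ∫ x in tsupport ψ, G x) := by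
  have main : ∀ s : Finset (Fin n),
      |(∫ x, DJ n (s.piecewise a b) x * ψ x) - ∫ x, DJ n b x * ψ x| ≤
      s.card * (n.factorial * B * ∫ x in tsupport ψ, G x) := by
    intro s
    induction s using Finset.induction_on with
    | empty => simp
    | insert m s hm ih =>
      set c := s.piecewise a b with hcdef
      have hc : ∀ i, ContDiff ℝ 2 (c i) := by
        intro i
        by_cases h : i ∈ s
        · simp only [hcdef, Finset.piecewise_eq_of_mem _ _ _ h]; exact ha i
        · simp only [hcdef, Finset.piecewise_eq_of_notMem _ _ _ h]; exact hb i
      have hβ : ∀ x ∈ tsupport ψ, ∀ i j, |fderiv ℝ (c i) x (bv n j)| ≤ β x := by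
        intro x hx i j
        by_cases h : i ∈ s
        · simp only [hcdef, Finset.piecewise_eq_of_mem _ _ _ h]; exact hβa x hx i j
        · simp only [hcdef, Finset.piecewise_eq_of_notMem _ _ _ h]; exact hβb x hx i j
      have e1 : (insert m s).piecewise a b = Function.update c m (a m) :=
        Finset.piecewise_insert _ _ _ _
      have e2 : c = Function.update c m (b m) := by
        rw [Function.eq_update_iff]
        refine ⟨?_, fun _ _ => rfl⟩
        simp [hcdef, hm]
      have hsb := step_bound n c hc m (fun y => a m y - b m y) ψ
        (((ha m).sub (hb m)).of_le (by norm_num)) hψ hψs B hB α β G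
        (fun x hx => hα x hx m) hβ hG hGi
      have hint : ∀ d : Fin n → Euc n → ℝ, (∀ i, ContDiff ℝ 2 (d i)) →
          Integrable fun x => DJ n d x * ψ x := fun d hd =>
        ((cont_DJ n d fun i => (hd i).of_le (by norm_num)).mul
          hψ.continuous).integrable_of_hasCompactSupport hψs.mul_left
      have e3 : (∫ x, DJ n ((insert m s).piecewise a b) x * ψ x) - ∫ x, DJ n c x * ψ x =
          ∫ x, DJ n (Function.update c m (fun y => a m y - b m y)) x * ψ x := by
        rw [← integral_sub (hint _ ?_) (hint c hc)]
        · congr 1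
          funext x
          rw [← sub_mul, e1]
          conv_lhs => rw [e2]
          rw [Function.update_idem, DJ_update_sub _ _ _ _ _ _
            ((ha m).differentiable (by norm_num) x) ((hb m).differentiable (by norm_num) x)]
        · intro i
          by_cases h : i ∈ insert m s
          · rw [Finset.piecewise_eq_of_mem _ _ _ h]; exact ha i
          · rw [Finset.piecewise_eq_of_notMem _ _ _ h]; exact hb i
      rw [← e3] at hsb
      rw [Finset.card_insert_of_notMem hm]
      push_cast
      have := abs_sub_le (∫ x, DJ n ((insert m s).piecewise a b) x * ψ x) (∫ x, DJ n c x * ψ x)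
        (∫ x, DJ n b x * ψ x)
      linarith
  have := main Finset.univ
  simpa using this

end

open MeasureTheory Metric Filter Topology
noncomputable section

/-- mollifier at scale `t` -/
structure Moll (n : ℕ) (M t : ℝ) (η : Euc n → ℝ) : Prop where
  smooth : ContDiff ℝ 2 η
  hcs : HasCompactSupport η
  zero : ∀ x, t < ‖x‖ → η x = 0
  zero' : ∀ x, t < ‖x‖ → fderiv ℝ η x = 0
  int : ∫ x, η x = 1
  b0 : ∀ x, |η x| ≤ M * (t ^ n)⁻¹
  b1 : ∀ x j, |fderiv ℝ η x (bv n j)| ≤ M * (t ^ n)⁻¹ * t⁻¹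

lemma norm_bv (n : ℕ) (j : Fin n) : ‖bv n j‖ = 1 := by simp [bv]

lemma exists_moll (n : ℕ) : ∃ M : ℝ, 0 < M ∧ ∃ η : ℝ → Euc n → ℝ, ∀ t > 0, Moll n M t (η t) := by
  let φ : ContDiffBump (0 : Euc n) := ⟨1/2, 1, by norm_num, by norm_num⟩
  set ρ : Euc n → ℝ := φ.normed volume with hρ
  have hs : ContDiff ℝ 2 ρ := φ.contDiff_normed (n := 2)
  have hc : HasCompactSupport ρ := φ.hasCompactSupport_normed
  have hts : tsupport ρ = closedBall 0 1 := φ.tsupport_normed_eq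
  have hi : ∫ x, ρ x = 1 := φ.integral_normed
  obtain ⟨M0, hM0⟩ := hc.exists_bound_of_continuous hs.continuous
  obtain ⟨M1, hM1⟩ := (hc.fderiv (𝕜 := ℝ)).exists_bound_of_continuous
    (hs.continuous_fderiv (by norm_num))
  set M := max 1 (max M0 M1)
  have hMM0 : M0 ≤ M := (le_max_left _ _).trans (le_max_right _ _)
  have hMM1 : M1 ≤ M := (le_max_right _ _).trans (le_max_right _ _)
  have hMpos : 0 < M := lt_of_lt_of_le one_pos (le_max_left _ _)
  refine ⟨M, hMpos, fun t x => (t ^ n)⁻¹ * ρ (t⁻¹ • x), fun t ht => ?_⟩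
  have htn : 0 < (t ^ n)⁻¹ := by positivity
  have hsm : ContDiff ℝ 2 fun x : Euc n => ρ (t⁻¹ • x) := hs.comp (contDiff_const_smul _)
  have hz : ∀ x : Euc n, t < ‖x‖ → t⁻¹ • x ∉ tsupport ρ := by
    intro x hx
    rw [hts, mem_closedBall_zero_iff, norm_smul, norm_inv, Real.norm_of_nonneg ht.le, not_le,
      inv_mul_eq_div, one_lt_div ht]
    exact hx
  have hfd : ∀ x : Euc n, fderiv ℝ (fun x => (t ^ n)⁻¹ * ρ (t⁻¹ • x)) x =
      (t ^ n)⁻¹ • (t⁻¹ • fderiv ℝ ρ (t⁻¹ • x)) := by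
    intro x
    rw [fderiv_const_mul (hsm.differentiable (by norm_num) x), fderiv_comp_smul]
  refine ⟨contDiff_const.mul hsm, ?_, ?_, ?_, ?_, ?_, ?_⟩
  · refine HasCompactSupport.intro (isCompact_closedBall 0 t) fun x hx => ?_
    rw [mem_closedBall_zero_iff, not_le] at hx
    change (t ^ n)⁻¹ * ρ (t⁻¹ • x) = 0
    rw [image_eq_zero_of_notMem_tsupport (hz x hx), mul_zero]
  · intro x hx
    change (t ^ n)⁻¹ * ρ (t⁻¹ • x) = 0
    rw [image_eq_zero_of_notMem_tsupport (hz x hx), mul_zero]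
  · intro x hx
    have : fderiv ℝ ρ (t⁻¹ • x) = 0 := by
      by_contra h
      exact hz x hx (support_fderiv_subset ℝ h)
    rw [hfd, this]; simp
  · rw [integral_const_mul, Measure.integral_comp_inv_smul, hi]
    simp [abs_of_pos ht]
    field_simp
  · intro x
    rw [abs_mul, abs_of_pos htn, mul_comm]
    exact mul_le_mul_of_nonneg_right ((hM0 _).trans hMM0) htn.le
  · intro x j
    rw [hfd]
    simp only [_root_.smul_apply, smul_eq_mul]
    rw [abs_mul, abs_mul, abs_of_pos htn, abs_of_pos (inv_pos.2 ht)]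
    have : |fderiv ℝ ρ (t⁻¹ • x) (bv n j)| ≤ M := by
      refine ((fderiv ℝ ρ (t⁻¹ • x)).le_opNorm _).trans ?_
      rw [norm_bv, mul_one]
      exact (hM1 _).trans hMM1
    calc (t ^ n)⁻¹ * (t⁻¹ * |fderiv ℝ ρ (t⁻¹ • x) (bv n j)|) ≤ (t ^ n)⁻¹ * (t⁻¹ * M) := by
          gcongr
      _ = M * (t ^ n)⁻¹ * t⁻¹ := by ring

/-- mollification -/
def mol (n : ℕ) (η f : Euc n → ℝ) : Euc n → ℝ :=
  convolution f η (ContinuousLinearMap.mul ℝ ℝ) volume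

section
variable {n : ℕ} {M t : ℝ} {η : Euc n → ℝ}

lemma mol_apply (η f : Euc n → ℝ) (x : Euc n) : mol n η f x = ∫ y, f y * η (x - y) := rfl

lemma mol_contDiff (h : Moll n M t η) {f : Euc n → ℝ} (hf : Integrable f) :
    ContDiff ℝ 2 (mol n η f) :=
  h.hcs.contDiff_convolution_right (n := 2) _ hf.locallyIntegrable h.smooth

lemma mol_fderiv (h : Moll n M t η) {f : Euc n → ℝ} (hf : Integrable f) (x v : Euc n) :
    fderiv ℝ (mol n η f) x v = ∫ y, f y * fderiv ℝ η (x - y) v := by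
  have h1 : ContDiff ℝ 1 η := h.smooth.of_le (by norm_num)
  have := h.hcs.hasFDerivAt_convolution_right (ContinuousLinearMap.mul ℝ ℝ)
    (μ := volume) hf.locallyIntegrable h1 x
  rw [mol, this.fderiv, convolution_precompR_apply _ hf.locallyIntegrable
    (h.hcs.fderiv (𝕜 := ℝ)) (h1.continuous_fderiv (by norm_num))]
  rfl

lemma ker_bound {k g : Euc n → ℝ} {C : ℝ} (x : Euc n) (hC : ∀ z, |k z| ≤ C)
    (hk : ∀ z, t < ‖z‖ → k z = 0) (hg : IntegrableOn g (closedBall x t)) :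
    |∫ y, g y * k (x - y)| ≤ C * ∫ y in closedBall x t, |g y| := by
  have h3 : ∫ y, g y * k (x - y) = ∫ y in closedBall x t, g y * k (x - y) := by
    rw [setIntegral_eq_integral_of_forall_compl_eq_zero]
    intro y hy
    rw [hk, mul_zero]
    rw [mem_closedBall, not_le, dist_comm, dist_eq_norm] at hy
    exact hy
  rw [h3, ← integral_const_mul]
  refine norm_integral_le_of_norm_le (f := fun y => g y * k (x - y)) (hg.abs.const_mul _) ?_
  refine ae_of_all _ fun y => ?_
  rw [Real.norm_eq_abs, abs_mul, mul_comm]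
  exact mul_le_mul_of_nonneg_right (hC _) (abs_nonneg _)

lemma int_ker (h : Moll n M t η) (x : Euc n) : ∫ y, η (x - y) = 1 := by
  rw [integral_sub_left_eq_self]; exact h.int

lemma integrable_fd (h : Moll n M t η) (v : Euc n) : Integrable fun y => fderiv ℝ η y v :=
  (cont_fderiv_apply (h.smooth.of_le (by norm_num)) v).integrable_of_hasCompactSupport
    (hcs_fderiv_apply h.hcs v)

lemma integrable_eta (h : Moll n M t η) : Integrable η :=
  h.smooth.continuous.integrable_of_hasCompactSupport h.hcs

lemma int_fd (h : Moll n M t η) (x v : Euc n) : ∫ y, fderiv ℝ η (x - y) v = 0 := by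
  rw [integral_sub_left_eq_self (fun y => fderiv ℝ η y v)]
  have := integral_mul_fderiv_eq_neg_fderiv_mul_of_integrable (𝕜 := ℝ) (μ := volume)
    (f := fun _ : Euc n => (1 : ℝ)) (g := η) (v := v)
    (by simp) (by simpa using integrable_fd h v) (by simpa using integrable_eta h)
    (fun x _ => differentiableAt_const _) (fun x _ => h.smooth.differentiable (by norm_num) x)
  simpa using this

lemma int_lin (h : Moll n M t η) (x v : Euc n) (l : Euc n →L[ℝ] ℝ) :
    ∫ y, l (y - x) * fderiv ℝ η (x - y) v = l v := by
  have e : ∀ y, l (y - x) * fderiv ℝ η (x - y) v =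
      (fun z => - (l z * fderiv ℝ η z v)) (x - y) := by
    intro y
    have : l (y - x) = - l (x - y) := by rw [← map_neg, neg_sub]
    rw [this, neg_mul]
  simp_rw [e]
  rw [integral_sub_left_eq_self (fun z => - (l z * fderiv ℝ η z v)), integral_neg]
  have hfl : ∀ y, fderiv ℝ (fun z => l z) y = l := fun y => l.fderiv
  have := integral_mul_fderiv_eq_neg_fderiv_mul_of_integrable (𝕜 := ℝ) (μ := volume)
    (f := fun z => l z) (g := η) (v := v)
    (by simp_rw [hfl]; exact (integrable_eta h).const_mul _)
    ((l.continuous.mul (cont_fderiv_apply (h.smooth.of_le (by norm_num)) v)).integrable_of_hasCompactSupport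
      ((hcs_fderiv_apply h.hcs v).mul_left))
    ((l.continuous.mul h.smooth.continuous).integrable_of_hasCompactSupport (h.hcs.mul_left))
    (fun x _ => l.differentiableAt) (fun x _ => h.smooth.differentiable (by norm_num) x)
  rw [this]
  simp_rw [hfl]
  rw [integral_const_mul, h.int]
  simp

lemma integrable_mul_ker {k f : Euc n → ℝ} (hk : Continuous k) {C : ℝ} (hC : ∀ z, |k z| ≤ C)
    (hf : Integrable f) (x : Euc n) : Integrable fun y => f y * k (x - y) := by
  refine hf.mul_bdd (c := C) ?_ ?_
  · exact (hk.comp (continuous_const.sub continuous_id)).aestronglyMeasurable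
  · exact ae_of_all _ fun y => hC _

lemma mol_sub_bound (h : Moll n M t η) {f : Euc n → ℝ} (hf : Integrable f) (x : Euc n) :
    |mol n η f x - f x| ≤ M * (t ^ n)⁻¹ * ∫ y in closedBall x t, |f y - f x| := by
  have e : mol n η f x - f x = ∫ y, (f y - f x) * η (x - y) := by
    simp_rw [sub_mul]
    rw [integral_sub (integrable_mul_ker h.smooth.continuous h.b0 hf x)
      (((integrable_eta h).comp_sub_left x).const_mul _), integral_const_mul, int_ker h, mul_one]
    rfl
  rw [e]
  exact ker_bound (g := fun y => f y - f x) x h.b0 h.zero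
    (hf.integrableOn.sub (integrableOn_const (measure_closedBall_lt_top).ne))

lemma mol_fderiv_bound (h : Moll n M t η) {f : Euc n → ℝ} (hf : Integrable f) (x : Euc n)
    (j : Fin n) :
    |fderiv ℝ (mol n η f) x (bv n j)| ≤
      M * (t ^ n)⁻¹ * t⁻¹ * ∫ y in closedBall x t, |f y - f x| := by
  have hcont := cont_fderiv_apply (h.smooth.of_le (by norm_num)) (bv n j)
  have e : fderiv ℝ (mol n η f) x (bv n j) =
      ∫ y, (f y - f x) * fderiv ℝ η (x - y) (bv n j) := by
    rw [mol_fderiv h hf]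
    simp_rw [sub_mul]
    rw [integral_sub (integrable_mul_ker hcont (fun z => h.b1 z j) hf x)
      (((integrable_fd h (bv n j)).comp_sub_left x).const_mul _), integral_const_mul,
      int_fd h, mul_zero, sub_zero]
  rw [e]
  exact ker_bound (k := fun z => fderiv ℝ η z (bv n j)) (g := fun y => f y - f x) x
    (fun z => h.b1 z j) (fun z hz => by simp [h.zero' z hz])
    (hf.integrableOn.sub (integrableOn_const (measure_closedBall_lt_top).ne))

lemma mol_fderiv_bound0 (h : Moll n M t η) {f : Euc n → ℝ} (hf : Integrable f) (x : Euc n)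
    (j : Fin n) :
    |fderiv ℝ (mol n η f) x (bv n j)| ≤ M * (t ^ n)⁻¹ * t⁻¹ * ∫ y, |f y| := by
  rw [mol_fderiv h hf, ← integral_const_mul]
  refine norm_integral_le_of_norm_le (f := fun y => f y * fderiv ℝ η (x - y) (bv n j))
    (hf.abs.const_mul _) ?_
  refine ae_of_all _ fun y => ?_
  rw [Real.norm_eq_abs, abs_mul, mul_comm]
  exact mul_le_mul_of_nonneg_right (h.b1 _ _) (abs_nonneg _)

lemma mol_fderiv_sub (h : Moll n M t η) {f g : Euc n → ℝ} (hf : Integrable f) (hg : Integrable g)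
    (x : Euc n) (j : Fin n) :
    fderiv ℝ (mol n η f) x (bv n j) - fderiv ℝ (mol n η g) x (bv n j) =
      fderiv ℝ (mol n η (fun y => f y - g y)) x (bv n j) := by
  have hcont := cont_fderiv_apply (h.smooth.of_le (by norm_num)) (bv n j)
  rw [mol_fderiv h hf, mol_fderiv h hg, mol_fderiv h (f := fun y => f y - g y) (hf.sub hg),
    ← integral_sub (integrable_mul_ker hcont (fun z => h.b1 z j) hf x)
      (integrable_mul_ker hcont (fun z => h.b1 z j) hg x)]
  simp_rw [sub_mul]

lemma mol_fderiv_lin (h : Moll n M t η) {f : Euc n → ℝ} (hf : Integrable f) (x : Euc n)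
    (j : Fin n) (l : Euc n →L[ℝ] ℝ) :
    |fderiv ℝ (mol n η f) x (bv n j) - l (bv n j)| ≤
      M * (t ^ n)⁻¹ * t⁻¹ * ∫ y in closedBall x t, |f y - f x - l (y - x)| := by
  have hcont := cont_fderiv_apply (h.smooth.of_le (by norm_num)) (bv n j)
  have hlc : Continuous fun y => l (y - x) :=
    l.continuous.comp (continuous_id.sub continuous_const)
  have e : fderiv ℝ (mol n η f) x (bv n j) - l (bv n j) =
      ∫ y, (f y - f x - l (y - x)) * fderiv ℝ η (x - y) (bv n j) := by
    rw [mol_fderiv h hf]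
    have i1 := integrable_mul_ker hcont (fun z => h.b1 z j) hf x
    have i2 := ((integrable_fd h (bv n j)).comp_sub_left x).const_mul (f x)
    have i3 : Integrable fun y => l (y - x) * fderiv ℝ η (x - y) (bv n j) := by
      refine (hlc.mul (hcont.comp
        (continuous_const.sub continuous_id))).integrable_of_hasCompactSupport ?_
      refine HasCompactSupport.mul_left ?_
      refine HasCompactSupport.intro (isCompact_closedBall x t) fun y hy => ?_
      rw [mem_closedBall, not_le, dist_comm, dist_eq_norm] at hy
      simp [h.zero' _ hy]
    simp_rw [sub_mul]
    have i12 : Integrable fun y => f y * fderiv ℝ η (x - y) (bv n j) -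
        f x * fderiv ℝ η (x - y) (bv n j) := i1.sub i2
    rw [integral_sub i12 i3, integral_sub i1 i2, integral_const_mul,
      int_fd h, mul_zero, sub_zero, int_lin h]
  rw [e]
  exact ker_bound (k := fun z => fderiv ℝ η z (bv n j)) (g := fun y => f y - f x - l (y - x)) x
    (fun z => h.b1 z j) (fun z hz => by simp [h.zero' z hz])
    ((hf.integrableOn.sub (integrableOn_const (measure_closedBall_lt_top).ne)).sub
      (hlc.continuousOn.integrableOn_compact (isCompact_closedBall x t)))

lemma vol_ball (n : ℕ) (x : Euc n) {t : ℝ} (ht : 0 ≤ t) :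
    volume.real (closedBall x t) = t ^ n * volume.real (ball (0 : Euc n) 1) := by
  rw [measureReal_def, Measure.addHaar_closedBall _ _ ht, ENNReal.toReal_mul,
    ENNReal.toReal_ofReal (by positivity)]
  simp [measureReal_def]

lemma mol_fderiv_tendsto {η : ℝ → Euc n → ℝ} (hM : 0 < M) (h : ∀ t > 0, Moll n M t (η t))
    {f : Euc n → ℝ} (hf : Integrable f) (x : Euc n) (hd : DifferentiableAt ℝ f x) (j : Fin n)
    (s : ℕ → ℝ) (hs : ∀ k, 0 < s k) (hs0 : Tendsto s atTop (𝓝 0)) :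
    Tendsto (fun k => fderiv ℝ (mol n (η (s k)) f) x (bv n j)) atTop
      (𝓝 (fderiv ℝ f x (bv n j))) := by
  set V := volume.real (ball (0 : Euc n) 1) with hV
  have hV0 : 0 ≤ V := measureReal_nonneg
  rw [Metric.tendsto_atTop]
  intro ε hε
  set c := ε / (2 * (M * (V + 1))) with hc
  have hc0 : 0 < c := by positivity
  have h1 := hd.hasFDerivAt.isLittleO.def hc0
  rw [Metric.eventually_nhds_iff_ball] at h1
  obtain ⟨r, hr, h1⟩ := h1
  have h2 : ∀ᶠ k in atTop, s k < r := (tendsto_order.1 hs0).2 r hr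
  obtain ⟨N, hN⟩ := eventually_atTop.1 h2
  refine ⟨N, fun k hk => ?_⟩
  have hsk := hs k
  have b := mol_fderiv_lin (h _ hsk) hf x j (fderiv ℝ f x)
  rw [Real.dist_eq]
  refine b.trans_lt ?_
  have b2 : ∫ y in closedBall x (s k), |f y - f x - fderiv ℝ f x (y - x)| ≤
      c * s k * volume.real (closedBall x (s k)) := by
    refine (le_abs_self _).trans ?_
    refine norm_setIntegral_le_of_norm_le_const measure_closedBall_lt_top
      (f := fun y => |f y - f x - fderiv ℝ f x (y - x)|) ?_
    intro y hy
    have hyr : y ∈ ball x r := closedBall_subset_ball (hN k hk) hy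
    have := h1 y hyr
    rw [Real.norm_eq_abs, abs_abs]
    refine this.trans ?_
    rw [mem_closedBall, dist_eq_norm] at hy
    exact mul_le_mul_of_nonneg_left hy hc0.le
  calc M * (s k ^ n)⁻¹ * (s k)⁻¹ * ∫ y in closedBall x (s k), |f y - f x - fderiv ℝ f x (y - x)|
      ≤ M * (s k ^ n)⁻¹ * (s k)⁻¹ * (c * s k * (s k ^ n * V)) := by
        rw [vol_ball n x hsk.le] at b2
        exact mul_le_mul_of_nonneg_left b2 (by positivity)
    _ = M * V * c := by field_simp
    _ ≤ M * (V + 1) * c := by gcongr; linarith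
    _ = ε / 2 := by rw [hc]; field_simp
    _ < ε := by linarith

end
end

open MeasureTheory Metric Filter Topology
noncomputable section

lemma jensen_pow {n : ℕ} (hn : 1 ≤ n) {S : Set (Euc n)} {g : Euc n → ℝ} (hS0 : volume S ≠ 0)
    (hS : volume S ≠ ⊤) (hg0 : ∀ x, 0 ≤ g x) (hg : IntegrableOn g S)
    (hgn : IntegrableOn (fun x => g x ^ n) S) :
    (∫ x in S, g x) ^ n ≤ volume.real S ^ (n - 1) * ∫ x in S, g x ^ n := by
  have := ConvexOn.map_set_average_le (μ := volume) (t := S) (f := g) (convexOn_pow (𝕜 := ℝ) n)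
    (continuous_pow n).continuousOn isClosed_Ici hS0 hS (ae_of_all _ hg0) hg hgn
  rw [setAverage_eq, setAverage_eq, smul_eq_mul, smul_eq_mul, mul_pow] at this
  have hv : 0 < volume.real S := by
    rw [measureReal_def]; exact ENNReal.toReal_pos hS0 hS
  obtain ⟨m, rfl⟩ : ∃ m, n = m + 1 := ⟨n - 1, by omega⟩
  simp only [Nat.add_sub_cancel]
  rw [inv_pow, inv_mul_le_iff₀ (by positivity)] at this
  refine this.trans (le_of_eq ?_)
  rw [pow_succ]
  field_simp

/-- zero extension of the components -/
def zcmp (n : ℕ) (Ω : Set (Euc n)) (v : Euc n → Euc n) (i : Fin n) : Euc n → ℝ :=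
  Ω.indicator fun x => v x i

lemma zcmp_integrable {n : ℕ} {Ω : Set (Euc n)} (hΩ : IsOpen Ω) {v : Euc n → Euc n}
    (hv : IntegrableOn v Ω) (i : Fin n) : Integrable (zcmp n Ω v i) := by
  unfold zcmp
  rw [integrable_indicator_iff hΩ.measurableSet]
  exact (EuclideanSpace.proj (𝕜 := ℝ) i).integrable_comp hv

/-- mollified Jacobian pairing -/
def AJ (n : ℕ) (Ω : Set (Euc n)) (ψ η : Euc n → ℝ) (v : Euc n → Euc n) : ℝ :=
  ∫ x, DJ n (fun i => mol n η (zcmp n Ω v i)) x * ψ x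

/-- truncated difference power -/
def Hf (n : ℕ) (t : ℝ) (v : Euc n → Euc n) (q : Euc n × Euc n) : ℝ :=
  {q : Euc n × Euc n | dist q.1 q.2 ≤ t}.indicator (fun q => ‖v q.1 - v q.2‖ ^ n) q

lemma Hf_meas {n : ℕ} {t : ℝ} {v : Euc n → Euc n} {μ : Measure (Euc n)} [SFinite μ]
    (hv : AEStronglyMeasurable v μ) : AEStronglyMeasurable (Hf n t v) (μ.prod μ) := by
  have h1 : AEStronglyMeasurable (fun q : Euc n × Euc n => ‖v q.1 - v q.2‖ ^ n) (μ.prod μ) :=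
    (hv.comp_fst.sub hv.comp_snd).norm.pow n
  exact h1.indicator (isClosed_le (continuous_fst.dist continuous_snd)
    continuous_const).measurableSet

lemma Hf_integrable {n : ℕ} {t : ℝ} {v : Euc n → Euc n} {Ω : Set (Euc n)} (hΩ : IsOpen Ω)
    (hΩb : Bornology.IsBounded Ω)
    (hv : AEStronglyMeasurable v (volume.restrict Ω)) {R : ℝ} (hR : ∀ x ∈ Ω, ‖v x‖ ≤ R) :
    Integrable (Hf n t v) ((volume.restrict Ω).prod (volume.restrict Ω)) := by
  have : IsFiniteMeasure (volume.restrict Ω) := ⟨by simpa using hΩb.measure_lt_top⟩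
  refine Integrable.of_bound (Hf_meas hv) ((2 * R) ^ n) ?_
  rw [Measure.prod_restrict]
  refine (ae_restrict_iff' (hΩ.measurableSet.prod hΩ.measurableSet)).2 (ae_of_all _ ?_)
  rintro ⟨x, y⟩ ⟨hx, hy⟩
  unfold Hf
  have h1 : ‖v x - v y‖ ≤ 2 * R := by
    have := norm_sub_le (v x) (v y)
    have := hR x hx
    have := hR y hy
    linarith
  refine (norm_indicator_le_norm_self _ _).trans ?_
  simp only [norm_pow, norm_norm]
  exact pow_le_pow_left₀ (norm_nonneg _) h1 n

lemma one_scale {n : ℕ} (hn : 1 ≤ n) {M t : ℝ} (hM : 0 < M) (ht : 0 < t) {Ω : Set (Euc n)}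
    (hΩ : IsOpen Ω) (hΩb : Bornology.IsBounded Ω)
    {ψ : Euc n → ℝ} (hψ : ContDiff ℝ 1 ψ) (hψs : HasCompactSupport ψ)
    {B : ℝ} (hB0 : 0 ≤ B) (hB : ∀ x j, |fderiv ℝ ψ x (bv n j)| ≤ B)
    (hK : ∀ x ∈ tsupport ψ, closedBall x t ⊆ Ω)
    {η₁ η₂ : Euc n → ℝ} (h₁ : Moll n M (t / 2) η₁) (h₂ : Moll n M t η₂)
    {v : Euc n → Euc n} (hv : AEStronglyMeasurable v (volume.restrict Ω)) {R : ℝ}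
    (hR : ∀ x ∈ Ω, ‖v x‖ ≤ R) :
    |AJ n Ω ψ η₁ v - AJ n Ω ψ η₂ v| ≤
      n * (n.factorial * B * ((M * 2 ^ (n + 1)) ^ n * volume.real (ball (0 : Euc n) 1) ^ (n - 1))) *
        ((t ^ (2 * n - 1))⁻¹ *
          ∫ q, Hf n t v q ∂((volume.restrict Ω).prod (volume.restrict Ω))) := by
  set μ := volume.restrict Ω with hμ
  have : IsFiniteMeasure μ := ⟨by simpa [hμ] using hΩb.measure_lt_top⟩
  set V := volume.real (ball (0 : Euc n) 1) with hV
  have hV0 : 0 ≤ V := measureReal_nonneg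
  have hHi : Integrable (Hf n t v) (μ.prod μ) := Hf_integrable hΩ hΩb hv hR
  have hKΩ : tsupport ψ ⊆ Ω := fun x hx => hK x hx (mem_closedBall_self ht.le)
  have hvi : IntegrableOn v Ω := by
    refine Integrable.of_bound hv R ?_
    exact (ae_restrict_iff' hΩ.measurableSet).2 (ae_of_all _ hR)
  set f := zcmp n Ω v with hf
  have hfi : ∀ i, Integrable (f i) := zcmp_integrable hΩ hvi
  set S : Euc n → ℝ := fun x => ∫ y in closedBall x t, ‖v y - v x‖ with hS
  set I : Euc n → ℝ := fun x => ∫ y, Hf n t v (x, y) ∂μ with hI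
  have hdi : ∀ x ∈ tsupport ψ, IntegrableOn (fun y => ‖v y - v x‖) (closedBall x t) := by
    intro x hx
    exact ((hvi.mono_set (hK x hx)).sub
      (integrableOn_const (measure_closedBall_lt_top).ne)).norm
  have hS0 : ∀ x, 0 ≤ S x := fun x => integral_nonneg fun y => norm_nonneg _
  have hfS : ∀ x ∈ tsupport ψ, ∀ i, ∀ r ≤ t,
      ∫ y in closedBall x r, |f i y - f i x| ≤ S x := by
    intro x hx i r hr
    have hsub : closedBall x r ⊆ closedBall x t := closedBall_subset_closedBall hr
    have h1 : ∫ y in closedBall x r, |f i y - f i x| ≤ ∫ y in closedBall x r, ‖v y - v x‖ := by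
      refine setIntegral_mono_on ((hfi i).integrableOn.sub
        (integrableOn_const (measure_closedBall_lt_top).ne)).abs ((hdi x hx).mono_set hsub)
        measurableSet_closedBall ?_
      intro y hy
      have hyΩ : y ∈ Ω := hK x hx (hsub hy)
      simp only [hf, zcmp, Set.indicator_of_mem hyΩ, Set.indicator_of_mem (hKΩ hx)]
      exact PiLp.norm_apply_le (v y - v x) i
    refine h1.trans ?_
    exact setIntegral_mono_set (hdi x hx) (ae_of_all _ fun y => norm_nonneg _)
      hsub.eventuallyLE
  have hIx : ∀ x ∈ tsupport ψ, I x = ∫ y in closedBall x t, ‖v y - v x‖ ^ n := by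
    intro x hx
    simp only [hI, hμ]
    have e : ∀ y, Hf n t v (x, y) = (closedBall x t).indicator (fun y => ‖v y - v x‖ ^ n) y := by
      intro y
      unfold Hf
      by_cases h : dist x y ≤ t
      · rw [Set.indicator_of_mem (by exact h),
          Set.indicator_of_mem (by rw [mem_closedBall, dist_comm]; exact h), norm_sub_rev]
      · rw [Set.indicator_of_notMem (by exact h),
          Set.indicator_of_notMem (by rw [mem_closedBall, dist_comm]; exact h)]
    simp_rw [e]
    rw [integral_indicator measurableSet_closedBall, Measure.restrict_restrict
      measurableSet_closedBall, Set.inter_eq_left.2 (hK x hx)]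
  have hSn : ∀ x ∈ tsupport ψ, S x ^ n ≤ (t ^ n * V) ^ (n - 1) * I x := by
    intro x hx
    rw [hIx x hx, ← vol_ball n x ht.le]
    refine jensen_pow hn (measure_closedBall_pos _ _ ht).ne' (measure_closedBall_lt_top).ne
      (fun y => norm_nonneg _) (hdi x hx) ?_
    have hvm : AEStronglyMeasurable v (volume.restrict (closedBall x t)) :=
      hv.mono_measure (Measure.restrict_mono (hK x hx) le_rfl)
    have : IsFiniteMeasure (volume.restrict (closedBall x t)) :=
      ⟨by simpa using measure_closedBall_lt_top⟩
    refine Integrable.of_bound ((hvm.sub aestronglyMeasurable_const).norm.pow n) ((2 * R) ^ n) ?_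
    refine (ae_restrict_iff' measurableSet_closedBall).2 (ae_of_all _ ?_)
    intro y hy
    have h1 : ‖v y - v x‖ ≤ 2 * R := by
      have := norm_sub_le (v y) (v x)
      have := hR y (hK x hx hy)
      have := hR x (hKΩ hx)
      linarith
    simp only [norm_pow, norm_norm]
    exact pow_le_pow_left₀ (norm_nonneg _) h1 n
  set C1 := M * 2 ^ (n + 1) with hC1
  have hC10 : 0 ≤ C1 := by positivity
  have hIi : Integrable I μ := hHi.integral_prod_left
  have hI0 : ∀ x, 0 ≤ I x := fun x => integral_nonneg fun y =>
    Set.indicator_nonneg (fun q _ => by positivity) _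
  have half : ((t / 2) ^ n)⁻¹ = 2 ^ n * (t ^ n)⁻¹ := by
    rw [div_pow]; field_simp
  have two : (1 : ℝ) ≤ 2 ^ n := one_le_pow₀ (by norm_num)
  have main := diff_bound n (fun i => mol n η₁ (f i)) (fun i => mol n η₂ (f i))
    (fun i => mol_contDiff h₁ (hfi i)) (fun i => mol_contDiff h₂ (hfi i)) ψ hψ hψs B hB
    (fun x => C1 * ((t ^ n)⁻¹ * S x)) (fun x => C1 * ((t ^ n)⁻¹ * t⁻¹ * S x))
    (fun x => C1 ^ n * V ^ (n - 1) * (t ^ (2 * n - 1))⁻¹ * I x) ?_ ?_ ?_ ?_ ?_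
  · refine main.trans ?_
    have h1 : ∫ x in tsupport ψ, C1 ^ n * V ^ (n - 1) * (t ^ (2 * n - 1))⁻¹ * I x ≤
        C1 ^ n * V ^ (n - 1) * ((t ^ (2 * n - 1))⁻¹ * ∫ q, Hf n t v q ∂(μ.prod μ)) := by
      rw [integral_const_mul, integral_prod _ hHi, ← mul_assoc]
      refine mul_le_mul_of_nonneg_left ?_ (by positivity)
      exact setIntegral_mono_set hIi (ae_of_all _ hI0) hKΩ.eventuallyLE
    calc n * (n.factorial * B * ∫ x in tsupport ψ, C1 ^ n * V ^ (n - 1) * (t ^ (2 * n - 1))⁻¹ * I x)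
        ≤ n * (n.factorial * B * (C1 ^ n * V ^ (n - 1) *
          ((t ^ (2 * n - 1))⁻¹ * ∫ q, Hf n t v q ∂(μ.prod μ)))) := by gcongr
      _ = _ := by ring
  · intro x hx i
    have b1 := mol_sub_bound h₁ (hfi i) x
    have b2 := mol_sub_bound h₂ (hfi i) x
    have c1 := hfS x hx i (t / 2) (by linarith)
    have c2 := hfS x hx i t le_rfl
    have d1 := b1.trans (mul_le_mul_of_nonneg_left c1 (by positivity))
    have d2 := b2.trans (mul_le_mul_of_nonneg_left c2 (by positivity))
    rw [half] at d1
    have d3 := abs_sub_le (mol n η₁ (f i) x) (f i x) (mol n η₂ (f i) x)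
    rw [abs_sub_comm (f i x)] at d3
    have hS' := hS0 x
    have p : 0 ≤ M * (t ^ n)⁻¹ * S x := by positivity
    calc _ ≤ M * (2 ^ n * (t ^ n)⁻¹) * S x + M * (t ^ n)⁻¹ * S x := by linarith
      _ = (2 ^ n + 1) * (M * (t ^ n)⁻¹ * S x) := by ring
      _ ≤ (2 ^ n * 2) * (M * (t ^ n)⁻¹ * S x) := by
          refine mul_le_mul_of_nonneg_right ?_ p
          linarith
      _ = _ := by rw [hC1]; ring
  · intro x hx i j
    have b1 := mol_fderiv_bound h₁ (hfi i) x j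
    have c1 := hfS x hx i (t / 2) (by linarith)
    have d1 := b1.trans (mul_le_mul_of_nonneg_left c1 (by positivity))
    rw [half] at d1
    refine d1.trans (le_of_eq ?_)
    rw [hC1]
    field_simp
    ring
  · intro x hx i j
    have b1 := mol_fderiv_bound h₂ (hfi i) x j
    have c1 := hfS x hx i t le_rfl
    have d1 := b1.trans (mul_le_mul_of_nonneg_left c1 (by positivity))
    refine d1.trans ?_
    have hS' := hS0 x
    have p : 0 ≤ M * (t ^ n)⁻¹ * t⁻¹ * S x := by positivity
    calc _ ≤ (2 ^ n * 2) * (M * (t ^ n)⁻¹ * t⁻¹ * S x) := by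
          refine le_mul_of_one_le_left p ?_
          linarith
      _ = _ := by rw [hC1]; ring
  · intro x hx
    have h1 := hSn x hx
    have e1 : C1 * ((t ^ n)⁻¹ * S x) * (C1 * ((t ^ n)⁻¹ * t⁻¹ * S x)) ^ (n - 1) =
        C1 ^ n * ((t ^ n)⁻¹) ^ n * t⁻¹ ^ (n - 1) * S x ^ n := by
      obtain ⟨m, rfl⟩ : ∃ m, n = m + 1 := ⟨n - 1, by omega⟩
      simp only [Nat.add_sub_cancel]
      ring
    rw [e1]
    calc _ ≤ C1 ^ n * ((t ^ n)⁻¹) ^ n * t⁻¹ ^ (n - 1) * ((t ^ n * V) ^ (n - 1) * I x) := by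
          gcongr
      _ = _ := by
        obtain ⟨m, rfl⟩ : ∃ m, n = m + 1 := ⟨n - 1, by omega⟩
        have e2 : 2 * (m + 1) - 1 = (m + 1) + m := by omega
        simp only [Nat.add_sub_cancel]
        rw [e2, mul_pow (t ^ (m + 1)) V m, pow_add t (m + 1) m]
        have ha : t ^ (m + 1) ≠ 0 := by positivity
        generalize t ^ (m + 1) = a at ha ⊢
        rw [inv_pow, inv_pow, mul_inv, pow_succ a m]
        field_simp
  · exact (hIi.mono_measure (Measure.restrict_mono hKΩ le_rfl)).const_mul _

lemma geo_aux {r : ℝ} (hr : 2 ≤ r) (J : ℕ) (k : ℕ) :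
    ∑ j ∈ Finset.Ico J (J + k), r ^ j ≤ r ^ (J + k) := by
  induction k with
  | zero => simp; positivity
  | succ k ih =>
    rw [← add_assoc, Finset.sum_Ico_succ_top (by omega), pow_succ]
    have : 0 < r ^ (J + k) := by positivity
    nlinarith

lemma geo_sum {p : ℕ} (hp : 1 ≤ p) {d : ℝ} (hd : 0 < d) (J k : ℕ) :
    ∑ j ∈ Finset.Ico J (J + k), (if d ≤ (1 / 2 : ℝ) ^ j then (((1 / 2 : ℝ) ^ j) ^ p)⁻¹ else 0) ≤
      2 * (d ^ p)⁻¹ := by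
  have hr : (2 : ℝ) ≤ 2 ^ p := by
    calc (2 : ℝ) = 2 ^ 1 := by norm_num
      _ ≤ 2 ^ p := pow_le_pow_right₀ (by norm_num) hp
  have e : ∀ j : ℕ, (((1 / 2 : ℝ) ^ j) ^ p)⁻¹ = (2 ^ p : ℝ) ^ j := by
    intro j
    rw [← pow_mul, ← pow_mul, one_div, inv_pow, inv_inv, mul_comm]
  induction k with
  | zero => simp; positivity
  | succ k ih =>
    rw [← add_assoc]
    by_cases h : d ≤ (1 / 2 : ℝ) ^ (J + k)
    · have h1 : ∑ j ∈ Finset.Ico J (J + k),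
          (if d ≤ (1 / 2 : ℝ) ^ j then (((1 / 2 : ℝ) ^ j) ^ p)⁻¹ else 0) ≤ (2 ^ p : ℝ) ^ (J + k) := by
        refine le_trans (Finset.sum_le_sum fun j _ => ?_) (geo_aux hr J k)
        split_ifs
        · rw [e]
        · positivity
      rw [Finset.sum_Ico_succ_top (by omega), if_pos h]
      have h2 : (((1 / 2 : ℝ) ^ (J + k)) ^ p)⁻¹ ≤ (d ^ p)⁻¹ := by gcongr
      rw [e] at *
      linarith
    · rw [Finset.sum_Ico_succ_top (by omega), if_neg h, add_zero]
      exact ih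

/-- Gagliardo kernel -/
def kerf (n : ℕ) (v : Euc n → Euc n) (q : Euc n × Euc n) : ℝ :=
  ‖v q.1 - v q.2‖ ^ n / dist q.1 q.2 ^ (2 * n - 1)

/-- near-diagonal set -/
def nd (n : ℕ) (J : ℕ) : Set (Euc n × Euc n) := {q | dist q.1 q.2 ≤ (1 / 2 : ℝ) ^ J}

lemma nd_meas (n J : ℕ) : MeasurableSet (nd n J) :=
  (isClosed_le (continuous_fst.dist continuous_snd) continuous_const).measurableSet

lemma kerf_nonneg (n : ℕ) (v : Euc n → Euc n) (q) : 0 ≤ kerf n v q := by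
  unfold kerf; positivity

lemma geo_ker {n : ℕ} (hn : 1 ≤ n) (v : Euc n → Euc n) (q : Euc n × Euc n) (J k : ℕ) :
    ∑ j ∈ Finset.Ico J (J + k), (((1 / 2 : ℝ) ^ j) ^ (2 * n - 1))⁻¹ * Hf n ((1 / 2 : ℝ) ^ j) v q ≤
      2 * (nd n J).indicator (kerf n v) q := by
  by_cases hq : q ∈ nd n J
  · rw [Set.indicator_of_mem hq]
    rcases eq_or_lt_of_le (dist_nonneg (x := q.1) (y := q.2)) with h | h
    · have h0 : q.1 = q.2 := dist_eq_zero.1 h.symm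
      have : ∀ t, Hf n t v q = 0 := by
        intro t
        unfold Hf
        refine Set.indicator_apply_eq_zero.2 fun _ => ?_
        simp [h0, show n ≠ 0 by omega]
      simp only [this, mul_zero, Finset.sum_const_zero]
      have := kerf_nonneg n v q
      linarith
    · have g := geo_sum (p := 2 * n - 1) (by omega) h J k
      have e : ∀ j, (((1 / 2 : ℝ) ^ j) ^ (2 * n - 1))⁻¹ * Hf n ((1 / 2 : ℝ) ^ j) v q =
          (if dist q.1 q.2 ≤ (1 / 2 : ℝ) ^ j then (((1 / 2 : ℝ) ^ j) ^ (2 * n - 1))⁻¹ else 0) *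
            ‖v q.1 - v q.2‖ ^ n := by
        intro j
        unfold Hf
        by_cases hj : dist q.1 q.2 ≤ (1 / 2 : ℝ) ^ j
        · rw [Set.indicator_of_mem (by exact hj), if_pos hj]
        · rw [Set.indicator_of_notMem (by exact hj), if_neg hj]; simp
      simp_rw [e, ← Finset.sum_mul]
      refine (mul_le_mul_of_nonneg_right g (by positivity)).trans (le_of_eq ?_)
      unfold kerf
      field_simp
  · rw [Set.indicator_of_notMem hq, mul_zero]
    refine (Finset.sum_eq_zero fun j hj => ?_).le
    have : q ∉ {q : Euc n × Euc n | dist q.1 q.2 ≤ (1 / 2 : ℝ) ^ j} := by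
      intro h
      refine hq (show dist q.1 q.2 ≤ (1 / 2 : ℝ) ^ J from le_trans h ?_)
      exact pow_le_pow_of_le_one (by norm_num) (by norm_num) (Finset.mem_Ico.1 hj).1
    unfold Hf
    rw [Set.indicator_of_notMem this, mul_zero]

/-- near-diagonal energy -/
def tailE (n : ℕ) (Ω : Set (Euc n)) (J : ℕ) (v : Euc n → Euc n) : ℝ :=
  ∫ q in nd n J, kerf n v q ∂((volume.restrict Ω).prod (volume.restrict Ω))

lemma multi_scale {n : ℕ} (hn : 1 ≤ n) {M : ℝ} (hM : 0 < M) {η : ℝ → Euc n → ℝ}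
    (hη : ∀ t > 0, Moll n M t (η t)) {Ω : Set (Euc n)}
    (hΩ : IsOpen Ω) (hΩb : Bornology.IsBounded Ω)
    {ψ : Euc n → ℝ} (hψ : ContDiff ℝ 1 ψ) (hψs : HasCompactSupport ψ)
    {B : ℝ} (hB0 : 0 ≤ B) (hB : ∀ x j, |fderiv ℝ ψ x (bv n j)| ≤ B) {J₀ : ℕ}
    (hK : ∀ x ∈ tsupport ψ, closedBall x ((1 / 2 : ℝ) ^ J₀) ⊆ Ω) :
    ∃ C : ℝ, 0 ≤ C ∧ ∀ (v : Euc n → Euc n) (R : ℝ),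
      AEStronglyMeasurable v (volume.restrict Ω) → (∀ x ∈ Ω, ‖v x‖ ≤ R) →
      Integrable (kerf n v) ((volume.restrict Ω).prod (volume.restrict Ω)) →
      ∀ J, J₀ ≤ J → ∀ k, |AJ n Ω ψ (η ((1 / 2 : ℝ) ^ (J + k))) v -
        AJ n Ω ψ (η ((1 / 2 : ℝ) ^ J)) v| ≤ C * tailE n Ω J v := by
  set μ := volume.restrict Ω with hμ
  set C := n * (n.factorial * B * ((M * 2 ^ (n + 1)) ^ n *
    volume.real (ball (0 : Euc n) 1) ^ (n - 1))) with hC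
  have hC0 : 0 ≤ C := by
    have : 0 ≤ volume.real (ball (0 : Euc n) 1) := measureReal_nonneg
    positivity
  refine ⟨C * 2, by positivity, fun v R hv hR hker J hJ k => ?_⟩
  have hHi : ∀ t, Integrable (Hf n t v) (μ.prod μ) := fun t => Hf_integrable hΩ hΩb hv hR
  have h1 : ∀ j, J ≤ j → |AJ n Ω ψ (η ((1 / 2 : ℝ) ^ (j + 1))) v -
        AJ n Ω ψ (η ((1 / 2 : ℝ) ^ j)) v| ≤
      C * ((((1 / 2 : ℝ) ^ j) ^ (2 * n - 1))⁻¹ * ∫ q, Hf n ((1 / 2 : ℝ) ^ j) v q ∂(μ.prod μ)) := by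
    intro j hj
    refine one_scale hn hM (by positivity) hΩ hΩb hψ hψs hB0 hB ?_ ?_ (hη _ (by positivity)) hv hR
    · intro x hx
      refine (closedBall_subset_closedBall ?_).trans (hK x hx)
      exact pow_le_pow_of_le_one (by norm_num) (by norm_num) (hJ.trans hj)
    · have : (1 / 2 : ℝ) ^ j / 2 = (1 / 2 : ℝ) ^ (j + 1) := by rw [pow_succ]; ring
      rw [this]
      exact hη _ (by positivity)
  have h2 := dist_le_Ico_sum_of_dist_le (f := fun j => AJ n Ω ψ (η ((1 / 2 : ℝ) ^ j)) v)
    (m := J) (n := J + k) (by omega)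
    (d := fun j => C * ((((1 / 2 : ℝ) ^ j) ^ (2 * n - 1))⁻¹ *
      ∫ q, Hf n ((1 / 2 : ℝ) ^ j) v q ∂(μ.prod μ)))
    (fun {j} hj _ => by
      rw [dist_comm, Real.dist_eq]
      exact h1 j hj)
  rw [dist_comm, Real.dist_eq] at h2
  refine h2.trans ?_
  rw [← Finset.mul_sum, mul_assoc C]
  refine mul_le_mul_of_nonneg_left ?_ hC0
  simp_rw [← integral_const_mul]
  rw [← integral_finsetSum _ (fun j _ => (hHi _).const_mul _)]
  unfold tailE
  rw [← integral_indicator (nd_meas n J), ← integral_const_mul]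
  refine integral_mono (integrable_finsetSum _ fun j _ => (hHi _).const_mul _)
    ((hker.indicator (nd_meas n J)).const_mul _) ?_
  intro q
  exact geo_ker hn v q J k

end

open MeasureTheory Metric Filter Topology
noncomputable section

lemma DJ_bound (n : ℕ) (c : Fin n → Euc n → ℝ) (x : Euc n) (β : ℝ)
    (hβ : ∀ i j, |fderiv ℝ (c i) x (bv n j)| ≤ β) :
    |DJ n c x| ≤ n.factorial * β ^ n := by
  have := Matrix.det_le (A := Matrix.of fun i j => fderiv ℝ (c i) x (bv n j))
    (abv := AbsoluteValue.abs) (x := β) (fun i j => hβ i j)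
  simpa [DJ] using this

lemma DJ_tendsto (n : ℕ) (c : ℕ → Fin n → Euc n → ℝ) (A : Matrix (Fin n) (Fin n) ℝ) (x : Euc n)
    (h : ∀ i j, Tendsto (fun k => fderiv ℝ (c k i) x (bv n j)) atTop (𝓝 (A i j))) :
    Tendsto (fun k => DJ n (c k) x) atTop (𝓝 A.det) := by
  have hd : Continuous fun M : Matrix (Fin n) (Fin n) ℝ => M.det := continuous_id.matrix_det
  refine (hd.tendsto A).comp ?_
  refine tendsto_pi_nhds.2 fun i => tendsto_pi_nhds.2 fun j => ?_
  exact h i j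

lemma AJ_stable {n : ℕ} {M t : ℝ} (hM : 0 < M) (ht : 0 < t) {η : Euc n → ℝ} (hη : Moll n M t η)
    {Ω : Set (Euc n)} (hΩ : IsOpen Ω)
    {ψ : Euc n → ℝ} (hψ : Continuous ψ) (hψs : HasCompactSupport ψ)
    {u : Euc n → Euc n} (hu : IntegrableOn u Ω) {vk : ℕ → Euc n → Euc n}
    (hv : ∀ k, IntegrableOn (vk k) Ω)
    (hlim : Tendsto (fun k => ∫ x in Ω, ‖vk k x - u x‖) atTop (𝓝 0)) :
    Tendsto (fun k => AJ n Ω ψ η (vk k)) atTop (𝓝 (AJ n Ω ψ η u)) := by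
  set D := M * (t ^ n)⁻¹ * t⁻¹ with hD
  have hD0 : 0 ≤ D := by positivity
  have hfi := fun i => zcmp_integrable hΩ hu i
  have hvi := fun k i => zcmp_integrable hΩ (hv k) i
  have key : ∀ k i j x, |fderiv ℝ (mol n η (zcmp n Ω (vk k) i)) x (bv n j) -
      fderiv ℝ (mol n η (zcmp n Ω u i)) x (bv n j)| ≤ D * ∫ x in Ω, ‖vk k x - u x‖ := by
    intro k i j x
    rw [mol_fderiv_sub hη (hvi k i) (hfi i)]
    refine (mol_fderiv_bound0 hη ((hvi k i).sub (hfi i)) x j).trans ?_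
    refine mul_le_mul_of_nonneg_left ?_ hD0
    rw [← integral_indicator hΩ.measurableSet]
    refine integral_mono ((hvi k i).sub (hfi i)).abs
      ((integrable_indicator_iff hΩ.measurableSet).2 ((hv k).sub hu).norm) ?_
    intro y
    by_cases hy : y ∈ Ω
    · change |zcmp n Ω (vk k) i y - zcmp n Ω u i y| ≤ _
      simp only [zcmp, Set.indicator_of_mem hy]
      exact PiLp.norm_apply_le (vk k y - u y) i
    · simp [zcmp, Set.indicator_of_notMem hy]
  have hDlim : Tendsto (fun k => D * ∫ x in Ω, ‖vk k x - u x‖) atTop (𝓝 0) := by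
    simpa using hlim.const_mul D
  have hent : ∀ i j x, Tendsto (fun k => fderiv ℝ (mol n η (zcmp n Ω (vk k) i)) x (bv n j)) atTop
      (𝓝 (fderiv ℝ (mol n η (zcmp n Ω u i)) x (bv n j))) := by
    intro i j x
    rw [tendsto_iff_dist_tendsto_zero]
    exact squeeze_zero (fun _ => dist_nonneg) (fun k => key k i j x) hDlim
  set β := 1 + D * ∑ i, ∫ y, |zcmp n Ω u i y| with hβ
  have hentb : ∀ᶠ k in atTop, ∀ x i j,
      |fderiv ℝ (mol n η (zcmp n Ω (vk k) i)) x (bv n j)| ≤ β := by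
    filter_upwards [(tendsto_order.1 hDlim).2 1 one_pos] with k hk x i j
    have h1 := key k i j x
    have h2 := mol_fderiv_bound0 hη (hfi i) x j
    have h3 : ∫ y, |zcmp n Ω u i y| ≤ ∑ i, ∫ y, |zcmp n Ω u i y| :=
      Finset.single_le_sum (f := fun i => ∫ y, |zcmp n Ω u i y|)
        (fun i _ => integral_nonneg fun y => abs_nonneg _) (Finset.mem_univ i)
    have h4 := mul_le_mul_of_nonneg_left h3 hD0
    have h5 := abs_sub_abs_le_abs_sub (fderiv ℝ (mol n η (zcmp n Ω (vk k) i)) x (bv n j))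
      (fderiv ℝ (mol n η (zcmp n Ω u i)) x (bv n j))
    linarith
  unfold AJ
  refine tendsto_integral_filter_of_dominated_convergence
    (fun x => n.factorial * β ^ n * |ψ x|) ?_ ?_ ?_ ?_
  · refine Eventually.of_forall fun k => ?_
    exact ((cont_DJ n _ fun i => (mol_contDiff hη (hvi k i)).of_le
      (by norm_num)).mul hψ).aestronglyMeasurable
  · filter_upwards [hentb] with k hk
    refine ae_of_all _ fun x => ?_
    rw [Real.norm_eq_abs, abs_mul]
    exact mul_le_mul_of_nonneg_right (DJ_bound n _ x β (hk x)) (abs_nonneg _)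
  · exact (hψ.integrable_of_hasCompactSupport hψs).abs.const_mul _
  · refine ae_of_all _ fun x => ?_
    refine Tendsto.mul_const _ ?_
    exact DJ_tendsto n _ _ x fun i j => hent i j x

lemma AJ_limit {n : ℕ} {M : ℝ} (hM : 0 < M) {η : ℝ → Euc n → ℝ}
    (hη : ∀ t > 0, Moll n M t (η t)) {Ω : Set (Euc n)} (hΩ : IsOpen Ω)
    {ψ : Euc n → ℝ} (hψ : Continuous ψ) (hψs : HasCompactSupport ψ) {J₀ : ℕ}
    (hK : ∀ x ∈ tsupport ψ, closedBall x ((1 / 2 : ℝ) ^ J₀) ⊆ Ω)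
    {v : Euc n → Euc n} (hv : IntegrableOn v Ω) (hd : ∀ x ∈ Ω, DifferentiableAt ℝ v x)
    {Λ : ℝ} (hΛ0 : 0 ≤ Λ) (hΛ : ∀ x ∈ Ω, ∀ y ∈ Ω, ‖v x - v y‖ ≤ Λ * ‖x - y‖) :
    Tendsto (fun k : ℕ => AJ n Ω ψ (η ((1 / 2 : ℝ) ^ k)) v) atTop
      (𝓝 (∫ x in Ω, (jacMat n v x).det * ψ x)) := by
  have hKΩ : tsupport ψ ⊆ Ω := fun x hx => hK x hx (mem_closedBall_self (by positivity))
  have hfi := fun i => zcmp_integrable hΩ hv i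
  set V := volume.real (ball (0 : Euc n) 1) with hV
  have e1 : ∫ x in Ω, (jacMat n v x).det * ψ x = ∫ x, (jacMat n v x).det * ψ x := by
    rw [setIntegral_eq_integral_of_forall_compl_eq_zero]
    intro x hx
    rw [image_eq_zero_of_notMem_tsupport (fun h => hx (hKΩ h)), mul_zero]
  rw [e1]
  have hent : ∀ x ∈ Ω, ∀ i j, Tendsto (fun k : ℕ => fderiv ℝ (mol n (η ((1 / 2 : ℝ) ^ k))
      (zcmp n Ω v i)) x (bv n j)) atTop (𝓝 (jacMat n v x i j)) := by
    intro x hx i j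
    have hev : zcmp n Ω v i =ᶠ[𝓝 x] fun y => v y i := by
      filter_upwards [hΩ.mem_nhds hx] with y hy
      simp [zcmp, Set.indicator_of_mem hy]
    have hvd : HasFDerivAt (fun y => v y i)
        ((EuclideanSpace.proj (𝕜 := ℝ) i : Euc n →L[ℝ] ℝ).comp (fderiv ℝ v x)) x :=
      (EuclideanSpace.proj (𝕜 := ℝ) i : Euc n →L[ℝ] ℝ).hasFDerivAt.comp x (hd x hx).hasFDerivAt
    have hz : HasFDerivAt (zcmp n Ω v i)
        ((EuclideanSpace.proj (𝕜 := ℝ) i : Euc n →L[ℝ] ℝ).comp (fderiv ℝ v x)) x :=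
      hvd.congr_of_eventuallyEq hev
    have := mol_fderiv_tendsto hM hη (hfi i) x hz.differentiableAt j (fun k => (1 / 2 : ℝ) ^ k)
      (fun k => by positivity) (tendsto_pow_atTop_nhds_zero_of_lt_one (by norm_num) (by norm_num))
    rw [hz.fderiv] at this
    exact this
  have hbd : ∀ k : ℕ, J₀ ≤ k → ∀ x ∈ tsupport ψ, ∀ i j, |fderiv ℝ (mol n (η ((1 / 2 : ℝ) ^ k))
      (zcmp n Ω v i)) x (bv n j)| ≤ M * Λ * V := by
    intro k hk x hx i j
    set t := (1 / 2 : ℝ) ^ k with ht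
    have ht0 : 0 < t := by positivity
    have hsub : closedBall x t ⊆ Ω := (closedBall_subset_closedBall
      (pow_le_pow_of_le_one (by norm_num) (by norm_num) hk)).trans (hK x hx)
    refine (mol_fderiv_bound (hη t ht0) (hfi i) x j).trans ?_
    have b2 : ∫ y in closedBall x t, |zcmp n Ω v i y - zcmp n Ω v i x| ≤
        Λ * t * volume.real (closedBall x t) := by
      refine (le_abs_self _).trans ?_
      refine norm_setIntegral_le_of_norm_le_const measure_closedBall_lt_top
        (f := fun y => |zcmp n Ω v i y - zcmp n Ω v i x|) ?_
      intro y hy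
      rw [Real.norm_eq_abs, abs_abs]
      simp only [zcmp, Set.indicator_of_mem (hsub hy), Set.indicator_of_mem (hKΩ hx)]
      refine (PiLp.norm_apply_le (v y - v x) i).trans ((hΛ y (hsub hy) x (hKΩ hx)).trans ?_)
      rw [mem_closedBall, dist_eq_norm] at hy
      exact mul_le_mul_of_nonneg_left hy hΛ0
    rw [vol_ball n x ht0.le] at b2
    calc _ ≤ M * (t ^ n)⁻¹ * t⁻¹ * (Λ * t * (t ^ n * V)) :=
          mul_le_mul_of_nonneg_left b2 (by positivity)
      _ = M * Λ * V := by field_simp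
  unfold AJ
  refine tendsto_integral_filter_of_dominated_convergence
    (fun x => n.factorial * (M * Λ * V) ^ n * |ψ x|) ?_ ?_ ?_ ?_
  · refine Eventually.of_forall fun k => ?_
    exact ((cont_DJ n _ fun i => (mol_contDiff (hη _ (by positivity)) (hfi i)).of_le
      (by norm_num)).mul hψ).aestronglyMeasurable
  · filter_upwards [eventually_ge_atTop J₀] with k hk
    refine ae_of_all _ fun x => ?_
    by_cases hx : x ∈ tsupport ψ
    · rw [Real.norm_eq_abs, abs_mul]
      exact mul_le_mul_of_nonneg_right (DJ_bound n _ x _ (hbd k hk x hx)) (abs_nonneg _)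
    · simp [image_eq_zero_of_notMem_tsupport hx]
  · exact (hψ.integrable_of_hasCompactSupport hψs).abs.const_mul _
  · refine ae_of_all _ fun x => ?_
    by_cases hx : x ∈ tsupport ψ
    · refine Tendsto.mul_const _ ?_
      exact DJ_tendsto n _ _ x fun i j => hent x (hKΩ hx) i j
    · simp [image_eq_zero_of_notMem_tsupport hx]

end

open MeasureTheory Metric Filter Topology
noncomputable section

lemma loc_deriv {n : ℕ} {Ω : Set (Euc n)} (hΩ : IsOpen Ω) {v : Euc n → Euc n}
    (hv : ContDiffOn ℝ 1 v (closure Ω)) {x₀ : Euc n} (hx₀ : x₀ ∈ closure Ω) :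
    ∃ ε > 0, ∃ K : ℝ, 0 ≤ K ∧ ∀ x ∈ Ω ∩ ball x₀ ε, DifferentiableAt ℝ v x ∧
      ‖fderiv ℝ v x‖ ≤ K := by
  have h := hv x₀ hx₀
  rw [show (1 : WithTop ℕ∞) = 0 + 1 by norm_num,
    contDiffWithinAt_succ_iff_hasFDerivWithinAt (by simp)] at h
  obtain ⟨S, hS, -, f', hf', hc⟩ := h
  rw [Set.insert_eq_of_mem hx₀] at hS
  have hx₀S : x₀ ∈ S := mem_of_mem_nhdsWithin hx₀ hS
  have hcont : ContinuousWithinAt f' S x₀ := hc.continuousWithinAt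
  have hb : ∀ᶠ x in 𝓝[S] x₀, ‖f' x‖ < ‖f' x₀‖ + 1 :=
    hcont.norm.eventually_lt_const (by linarith)
  obtain ⟨ε₁, h₁, hb1⟩ := Metric.mem_nhdsWithin_iff.1 hb
  obtain ⟨ε₂, h₂, hb2⟩ := Metric.mem_nhdsWithin_iff.1 hS
  refine ⟨min ε₁ ε₂, lt_min h₁ h₂, ‖f' x₀‖ + 1, by positivity, ?_⟩
  rintro x ⟨hxΩ, hx⟩
  have hx1 : x ∈ ball x₀ ε₁ := ball_subset_ball (min_le_left _ _) hx
  have hx2 : x ∈ ball x₀ ε₂ := ball_subset_ball (min_le_right _ _) hx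
  have hxS : x ∈ S := hb2 ⟨hx2, subset_closure hxΩ⟩
  have hSn : S ∈ 𝓝 x := by
    refine mem_of_superset ((isOpen_ball.inter hΩ).mem_nhds ⟨hx2, hxΩ⟩) ?_
    exact fun z hz => hb2 ⟨hz.1, subset_closure hz.2⟩
  have hd : HasFDerivAt v (f' x) x := (hf' x hxS).hasFDerivAt hSn
  refine ⟨hd.differentiableAt, ?_⟩
  rw [hd.fderiv]
  exact (hb1 ⟨hx1, hxS⟩).le

lemma seg_bound {n : ℕ} {S : Set (Euc n)} {v : Euc n → Euc n} {K : ℝ}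
    (h : ∀ x ∈ S, DifferentiableAt ℝ v x ∧ ‖fderiv ℝ v x‖ ≤ K) {x y : Euc n}
    (hs : segment ℝ x y ⊆ S) : ‖v y - v x‖ ≤ K * ‖y - x‖ :=
  Convex.norm_image_sub_le_of_norm_fderiv_le (𝕜 := ℝ) (fun z hz => (h z (hs hz)).1)
    (fun z hz => (h z (hs hz)).2) (convex_segment x y) (left_mem_segment ℝ x y)
    (right_mem_segment ℝ x y)

lemma loc_lip {n : ℕ} {Ω : Set (Euc n)} (hΩ : IsOpen Ω) (hs : SmoothBoundary n Ω)
    {v : Euc n → Euc n}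
    (hv : ContDiffOn ℝ 1 v (closure Ω)) {x₀ : Euc n} (hx₀ : x₀ ∈ closure Ω) :
    ∃ ε > 0, ∃ Λ : ℝ, 0 ≤ Λ ∧ ∀ x ∈ Ω ∩ ball x₀ ε, ∀ y ∈ Ω ∩ ball x₀ ε,
      ‖v x - v y‖ ≤ Λ * ‖x - y‖ := by
  obtain ⟨ε₁, h₁, K, hK0, hK⟩ := loc_deriv hΩ hv hx₀
  by_cases hxΩ : x₀ ∈ Ω
  · obtain ⟨ε₂, h₂, hb⟩ := Metric.isOpen_iff.1 hΩ x₀ hxΩ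
    refine ⟨min ε₁ ε₂, lt_min h₁ h₂, K, hK0, fun x hx y hy => ?_⟩
    refine seg_bound hK ?_
    intro z hz
    have := (convex_ball x₀ (min ε₁ ε₂)).segment_subset hy.2 hx.2 hz
    exact ⟨hb (ball_subset_ball (min_le_right _ _) this),
      ball_subset_ball (min_le_left _ _) this⟩
  obtain ⟨f, hf, hΩf, hdf⟩ := hs
  have hfr : x₀ ∈ frontier Ω := by
    rw [frontier, hΩ.interior_eq]; exact ⟨hx₀, hxΩ⟩
  have hne := hdf x₀ hfr
  set L := fderiv ℝ f x₀ with hL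
  obtain ⟨e, he⟩ : ∃ e, L e = -2 := by
    obtain ⟨w, hw⟩ : ∃ w, L w ≠ 0 := by
      by_contra hcon
      push Not at hcon
      exact hne (ContinuousLinearMap.ext fun w => by simpa using hcon w)
    refine ⟨(-2 / L w) • w, ?_⟩
    rw [map_smul, smul_eq_mul]; field_simp
  have hstr : HasStrictFDerivAt f L x₀ := hf.contDiffAt.hasStrictFDerivAt (by simp)
  set c : ℝ := (1 + ‖e‖)⁻¹ with hc
  have hc0 : 0 < c := by positivity
  have hce : c * ‖e‖ ≤ 1 := by
    rw [hc, inv_mul_le_iff₀ (by positivity)]; linarith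
  obtain ⟨S, hS, hap⟩ := hstr.approximates_deriv_on_nhds (c := ⟨c, hc0.le⟩) (Or.inr hc0)
  obtain ⟨ε₂, h₂, hb⟩ := Metric.mem_nhds_iff.1 hS
  have happ : ∀ z ∈ ball x₀ ε₂, ∀ w ∈ ball x₀ ε₂, |f z - f w - L (z - w)| ≤ c * ‖z - w‖ :=
    fun z hz w hw => hap z (hb hz) w (hb hw)
  set ε := min ε₁ ε₂ with hε
  have hε0 : 0 < ε := lt_min h₁ h₂
  set M := ‖L‖ + c with hM
  have hM0 : 0 ≤ M := by positivity
  set ρ := ε / (1 + 2 * M * ‖e‖) with hρ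
  have hden : 0 < 1 + 2 * M * ‖e‖ := by positivity
  have hρ0 : 0 < ρ := by positivity
  have hρe : ρ * (1 + 2 * M * ‖e‖) = ε := by rw [hρ]; field_simp
  have hρle : ρ ≤ ε := by
    have : 0 ≤ ρ * (2 * M * ‖e‖) := by positivity
    linarith
  have hB1 : ball x₀ ε ⊆ ball x₀ ε₁ := ball_subset_ball (min_le_left _ _)
  have hB2 : ball x₀ ε ⊆ ball x₀ ε₂ := ball_subset_ball (min_le_right _ _)
  have memΩ : ∀ z, z ∈ Ω ↔ f z < 0 := fun z => by rw [hΩf]; rfl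
  refine ⟨ρ, hρ0, K * (1 + 2 * M * ‖e‖), by positivity, fun x hx y hy => ?_⟩
  set r := ‖x - y‖ with hr
  have hr0 : 0 ≤ r := norm_nonneg _
  have hr2 : r < 2 * ρ := by
    have h1 := mem_ball_iff_norm.1 hx.2
    have h2 := mem_ball_iff_norm.1 hy.2
    have h3 : r ≤ ‖x - x₀‖ + ‖y - x₀‖ := by
      rw [hr, show x - y = (x - x₀) - (y - x₀) by abel]; exact norm_sub_le _ _
    linarith
  set τ := M * r with hτ
  have hτ0 : 0 ≤ τ := by positivity
  -- moving in direction e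
  have hball : ∀ z ∈ ball x₀ ρ, ∀ s, 0 ≤ s → s ≤ τ → z + s • e ∈ ball x₀ ε := by
    intro z hz s hs0 hsτ
    rw [mem_ball_iff_norm] at hz ⊢
    have h1 : ‖z + s • e - x₀‖ ≤ ‖z - x₀‖ + s * ‖e‖ := by
      rw [show z + s • e - x₀ = (z - x₀) + s • e by abel]
      refine (norm_add_le _ _).trans ?_
      rw [norm_smul, Real.norm_of_nonneg hs0]
    have h2 : s * ‖e‖ ≤ M * (2 * ρ) * ‖e‖ := by
      refine mul_le_mul_of_nonneg_right (hsτ.trans ?_) (norm_nonneg _)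
      exact mul_le_mul_of_nonneg_left hr2.le hM0
    nlinarith
  have hdec : ∀ z ∈ ball x₀ ρ, ∀ s, 0 ≤ s → s ≤ τ → f (z + s • e) ≤ f z - s := by
    intro z hz s hs0 hsτ
    have h := happ _ (hB2 (hball z hz s hs0 hsτ)) z (hB2 (ball_subset_ball hρle hz))
    rw [add_sub_cancel_left, map_smul, he, norm_smul, Real.norm_of_nonneg hs0, smul_eq_mul] at h
    have h1 := (abs_le.1 h).2
    have h2 := mul_le_mul_of_nonneg_left hce hs0
    nlinarith
  have hseg : ∀ z ∈ Ω ∩ ball x₀ ρ, segment ℝ z (z + τ • e) ⊆ Ω ∩ ball x₀ ε₁ := by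
    rintro z ⟨hzΩ, hz⟩ w hw
    rw [segment_eq_image'] at hw
    obtain ⟨θ, ⟨hθ0, hθ1⟩, rfl⟩ := hw
    simp only [add_sub_cancel_left, smul_smul]
    have hs1 : θ * τ ≤ τ := by nlinarith
    have hs0 : 0 ≤ θ * τ := by positivity
    refine ⟨?_, hB1 (hball z hz _ hs0 hs1)⟩
    rw [memΩ] at hzΩ ⊢
    have := hdec z hz _ hs0 hs1
    linarith
  have hmid : segment ℝ (y + τ • e) (x + τ • e) ⊆ Ω ∩ ball x₀ ε₁ := by
    intro w hw
    have hwb := (convex_ball x₀ ε).segment_subset (hball y hy.2 τ hτ0 le_rfl)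
      (hball x hx.2 τ hτ0 le_rfl) hw
    refine ⟨?_, hB1 hwb⟩
    rw [segment_eq_image'] at hw
    obtain ⟨θ, ⟨hθ0, hθ1⟩, rfl⟩ := hw
    have h := happ _ (hB2 hwb) _ (hB2 (hball y hy.2 τ hτ0 le_rfl))
    simp only [add_sub_add_right_eq_sub, add_sub_cancel_left] at h hwb ⊢
    have hn1 : ‖θ • (x - y)‖ ≤ r := by
      rw [norm_smul, Real.norm_of_nonneg hθ0]; nlinarith
    have h1 := (abs_le.1 h).2
    have h2 : L (θ • (x - y)) ≤ ‖L‖ * r :=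
      (le_abs_self _).trans ((L.le_opNorm _).trans (mul_le_mul_of_nonneg_left hn1 (norm_nonneg _)))
    have h3 := mul_le_mul_of_nonneg_left hn1 hc0.le
    have h4 := hdec y hy.2 τ hτ0 le_rfl
    have h5 := (memΩ y).1 hy.1
    rw [memΩ]
    have h6 : τ = ‖L‖ * r + c * r := by rw [hτ, hM]; ring
    linarith
  have e1 := seg_bound hK (hseg x hx)
  have e2 := seg_bound hK hmid
  have e3 := seg_bound hK (hseg y hy)
  rw [add_sub_cancel_left, norm_smul, Real.norm_of_nonneg hτ0] at e1 e3
  rw [add_sub_add_right_eq_sub] at e2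
  have e4 : ‖v x - v y‖ ≤ ‖v (x + τ • e) - v x‖ + ‖v (x + τ • e) - v (y + τ • e)‖ +
      ‖v (y + τ • e) - v y‖ := by
    rw [show v x - v y = -(v (x + τ • e) - v x) + (v (x + τ • e) - v (y + τ • e)) +
      (v (y + τ • e) - v y) by abel]
    refine (norm_add_le _ _).trans (add_le_add_left ((norm_add_le _ _).trans ?_) _)
    rw [norm_neg]
  have e5 : K * (1 + 2 * M * ‖e‖) * r = K * (τ * ‖e‖) + K * r + K * (τ * ‖e‖) := by
    rw [hτ]; ring
  rw [e5]; linarith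

lemma v_bdd {n : ℕ} {Ω : Set (Euc n)} (hb : Bornology.IsBounded Ω) {v : Euc n → Euc n}
    (hv : ContDiffOn ℝ 1 v (closure Ω)) : ∃ R, 0 ≤ R ∧ ∀ x ∈ Ω, ‖v x‖ ≤ R := by
  obtain ⟨R, hR⟩ := hb.isCompact_closure.exists_bound_of_continuousOn hv.continuousOn
  exact ⟨max R 0, le_max_right _ _, fun x hx => (hR x (subset_closure hx)).trans (le_max_left _ _)⟩

lemma glob_lip {n : ℕ} {Ω : Set (Euc n)} (hΩ : IsOpen Ω) (hb : Bornology.IsBounded Ω)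
    (hs : SmoothBoundary n Ω) {v : Euc n → Euc n}
    (hv : ContDiffOn ℝ 1 v (closure Ω)) :
    ∃ Λ : ℝ, 0 ≤ Λ ∧ ∀ x ∈ Ω, ∀ y ∈ Ω, ‖v x - v y‖ ≤ Λ * ‖x - y‖ := by
  obtain ⟨R, hR0, hR⟩ := v_bdd hb hv
  have hc : IsCompact (closure Ω ×ˢ closure Ω) := hb.isCompact_closure.prod hb.isCompact_closure
  have key := hc.induction_on (p := fun S => ∃ Λ : ℝ, 0 ≤ Λ ∧ ∀ q ∈ S, q.1 ∈ Ω → q.2 ∈ Ω →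
      ‖v q.1 - v q.2‖ ≤ Λ * ‖q.1 - q.2‖) ⟨0, le_rfl, by simp⟩
    (fun S T hST ⟨Λ, h0, h⟩ => ⟨Λ, h0, fun q hq => h q (hST hq)⟩) ?_ ?_
  · obtain ⟨Λ, h0, h⟩ := key
    exact ⟨Λ, h0, fun x hx y hy => h (x, y) ⟨subset_closure hx, subset_closure hy⟩ hx hy⟩
  · rintro S T ⟨Λ₁, h1, hS⟩ ⟨Λ₂, h2, hT⟩
    refine ⟨max Λ₁ Λ₂, le_max_of_le_left h1, ?_⟩
    rintro q (hq | hq) ha hb'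
    · exact (hS q hq ha hb').trans
        (mul_le_mul_of_nonneg_right (le_max_left _ _) (norm_nonneg _))
    · exact (hT q hq ha hb').trans
        (mul_le_mul_of_nonneg_right (le_max_right _ _) (norm_nonneg _))
  · rintro ⟨x₀, y₀⟩ ⟨hx, hy⟩
    by_cases hxy : x₀ = y₀
    · subst hxy
      obtain ⟨ε, hε, Λ, h0, h⟩ := loc_lip hΩ hs hv hx
      refine ⟨ball x₀ ε ×ˢ ball x₀ ε, mem_nhdsWithin_of_mem_nhds
        (prod_mem_nhds (ball_mem_nhds _ hε) (ball_mem_nhds _ hε)), Λ, h0, ?_⟩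
      rintro ⟨x, y⟩ ⟨h1, h2⟩ h3 h4
      exact h x ⟨h3, h1⟩ y ⟨h4, h2⟩
    · have hd : 0 < ‖x₀ - y₀‖ := norm_pos_iff.2 (sub_ne_zero.2 hxy)
      have hcn : Continuous fun q : Euc n × Euc n => ‖q.1 - q.2‖ := by fun_prop
      refine ⟨{q | ‖x₀ - y₀‖ / 2 < ‖q.1 - q.2‖}, mem_nhdsWithin_of_mem_nhds
        ((isOpen_lt continuous_const hcn).mem_nhds (by simp only [Set.mem_setOf_eq]; linarith)),
        4 * R / ‖x₀ - y₀‖, by positivity, ?_⟩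
      rintro ⟨x, y⟩ h1 h3 h4
      simp only [Set.mem_setOf_eq] at h1 h3 h4 ⊢
      have h5 := norm_sub_le (v x) (v y)
      have h6 := hR x h3
      have h7 := hR y h4
      have h8 : 2 * R ≤ 4 * R / ‖x₀ - y₀‖ * ‖x - y‖ := by
        rw [div_mul_eq_mul_div, le_div_iff₀ hd]; nlinarith
      linarith

end

open MeasureTheory Metric Filter Topology
noncomputable section

lemma kerf_meas {n : ℕ} {Ω : Set (Euc n)} {v : Euc n → Euc n}
    (hv : AEStronglyMeasurable v (volume.restrict Ω)) :
    AEStronglyMeasurable (kerf n v) ((volume.restrict Ω).prod (volume.restrict Ω)) := by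
  unfold kerf
  have h1 : AEStronglyMeasurable (fun q : Euc n × Euc n => ‖v q.1 - v q.2‖ ^ n)
      ((volume.restrict Ω).prod (volume.restrict Ω)) :=
    ((hv.comp_fst.sub hv.comp_snd).norm).pow n
  have h2 : Measurable (fun q : Euc n × Euc n => (dist q.1 q.2 ^ (2 * n - 1))⁻¹) := by
    fun_prop
  simp only [div_eq_mul_inv]
  exact h1.mul h2.aestronglyMeasurable

lemma radial_int {n : ℕ} (hn : 2 ≤ n) (ρ : ℝ) :
    Integrable (fun z : Euc n => (Set.Iio ρ).indicator (fun r : ℝ => (r ^ (n - 1))⁻¹) ‖z‖) := by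
  have : Nontrivial (Euc n) := by
    have : Nontrivial (Fin n) := Fin.nontrivial_iff_two_le.2 hn
    infer_instance
  rw [integrable_fun_norm_addHaar volume (f := (Set.Iio ρ).indicator (fun r : ℝ => (r ^ (n - 1))⁻¹))]
  have h1 : IntegrableOn (fun _ : ℝ => (1 : ℝ)) (Set.Ioo 0 ρ) :=
    integrableOn_const (by simp)
  have h2 : IntegrableOn ((Set.Iio ρ).indicator fun _ : ℝ => (1 : ℝ)) (Set.Ioi 0) := by
    rw [integrableOn_indicator_iff measurableSet_Iio, Set.inter_comm]
    exact h1
  refine h2.congr_fun ?_ measurableSet_Ioi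
  intro y hy
  have hy0 : y ≠ 0 := ne_of_gt hy
  by_cases h : y ∈ Set.Iio ρ
  · simp only [Set.indicator_of_mem h, finrank_euclideanSpace, Fintype.card_fin, smul_eq_mul]
    field_simp
  · simp [Set.indicator_of_notMem h]

lemma kerf_lip_int {n : ℕ} (hn : 2 ≤ n) {Ω : Set (Euc n)} (hΩ : IsOpen Ω)
    (hb : Bornology.IsBounded Ω) {v : Euc n → Euc n}
    (hv : AEStronglyMeasurable v (volume.restrict Ω)) {Λ : ℝ}
    (hΛ : ∀ x ∈ Ω, ∀ y ∈ Ω, ‖v x - v y‖ ≤ Λ * ‖x - y‖) :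
    Integrable (kerf n v) ((volume.restrict Ω).prod (volume.restrict Ω)) := by
  obtain ⟨ρ, hρ⟩ := hb.subset_ball (0 : Euc n)
  set g : Euc n → ℝ := fun z => (Set.Iio (2 * ρ)).indicator (fun r : ℝ => (r ^ (n - 1))⁻¹) ‖z‖
    with hg
  have hgi : Integrable g := radial_int hn (2 * ρ)
  have h1 : Integrable (Ω.indicator fun _ : Euc n => (1 : ℝ)) := by
    rw [integrable_indicator_iff hΩ.measurableSet]
    exact integrableOn_const hb.measure_lt_top.ne
  have h2 := Integrable.convolution_integrand (ContinuousLinearMap.mul ℝ ℝ) (μ := volume) h1 hgi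
  have h3 : Integrable (fun p : Euc n × Euc n =>
      Λ ^ n * (Ω.indicator (fun _ : Euc n => (1 : ℝ)) p.2 * g (p.1 - p.2)))
      ((volume.restrict Ω).prod (volume.restrict Ω)) := by
    rw [Measure.prod_restrict]
    exact (h2.const_mul (Λ ^ n)).restrict
  refine h3.mono' (kerf_meas hv) ?_
  rw [Measure.prod_restrict]
  refine (ae_restrict_iff' (hΩ.measurableSet.prod hΩ.measurableSet)).2 (ae_of_all _ ?_)
  rintro ⟨x, y⟩ ⟨hx, hy⟩
  rw [Real.norm_of_nonneg (kerf_nonneg _ _ _)]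
  simp only at hx hy
  have hlt : ‖x - y‖ < 2 * ρ := by
    have h1 := mem_ball_zero_iff.1 (hρ hx)
    have h2 := mem_ball_zero_iff.1 (hρ hy)
    have := norm_sub_le x y
    linarith
  simp only [kerf, Set.indicator_of_mem hy, one_mul, hg]
  rw [Set.indicator_of_mem (show ‖x - y‖ ∈ Set.Iio (2 * ρ) from hlt), dist_eq_norm]
  by_cases hxy : x = y
  · subst hxy
    simp only [sub_self, norm_zero]
    rw [zero_pow (by omega : n ≠ 0), zero_pow (by omega : n - 1 ≠ 0)]
    simp
  have hd : 0 < ‖x - y‖ := norm_pos_iff.2 (sub_ne_zero.2 hxy)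
  rw [div_le_iff₀ (by positivity)]
  have h4 := pow_le_pow_left₀ (norm_nonneg _) (hΛ x hx y hy) n
  refine h4.trans (le_of_eq ?_)
  rw [mul_pow, show 2 * n - 1 = n + (n - 1) by omega, pow_add]
  field_simp

lemma kerf_add (n : ℕ) (v w : Euc n → Euc n) (q) :
    kerf n (v + w) q ≤ 2 ^ (n - 1) * (kerf n v q + kerf n w q) := by
  unfold kerf
  rw [← add_div, ← mul_div_assoc]
  refine div_le_div_of_nonneg_right ?_ (by positivity)
  refine le_trans ?_ (add_pow_le (norm_nonneg _) (norm_nonneg _) n)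
  refine pow_le_pow_left₀ (norm_nonneg _) ?_ n
  refine le_trans (le_of_eq ?_) (norm_add_le _ _)
  simp only [Pi.add_apply]
  congr 1; abel

lemma kerf_neg (n : ℕ) (v : Euc n → Euc n) (q) : kerf n (-v) q = kerf n v q := by
  unfold kerf
  congr 2
  rw [← norm_neg]; congr 1; simp only [Pi.neg_apply]; abel

lemma kerf_sub_int {n : ℕ} {Ω : Set (Euc n)} {v w : Euc n → Euc n}
    (hvm : AEStronglyMeasurable v (volume.restrict Ω))
    (hwm : AEStronglyMeasurable w (volume.restrict Ω))
    (hv : Integrable (kerf n v) ((volume.restrict Ω).prod (volume.restrict Ω)))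
    (hw : Integrable (kerf n w) ((volume.restrict Ω).prod (volume.restrict Ω))) :
    Integrable (kerf n (v - w)) ((volume.restrict Ω).prod (volume.restrict Ω)) := by
  refine ((hv.add hw).const_mul (2 ^ (n - 1))).mono' (kerf_meas (hvm.sub hwm)) (ae_of_all _ ?_)
  intro q
  rw [Real.norm_of_nonneg (kerf_nonneg _ _ _), sub_eq_add_neg]
  have := kerf_add n v (-w) q
  rwa [kerf_neg] at this

lemma tailE_le {n : ℕ} {Ω : Set (Euc n)} {v w : Euc n → Euc n}
    (hvm : AEStronglyMeasurable v (volume.restrict Ω))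
    (hwm : AEStronglyMeasurable w (volume.restrict Ω))
    (hv : Integrable (kerf n v) ((volume.restrict Ω).prod (volume.restrict Ω)))
    (hw : Integrable (kerf n w) ((volume.restrict Ω).prod (volume.restrict Ω))) (J : ℕ) :
    tailE n Ω J v ≤ 2 ^ (n - 1) * (tailE n Ω J w +
      ∫ q, kerf n (v - w) q ∂((volume.restrict Ω).prod (volume.restrict Ω))) := by
  have hd := kerf_sub_int hvm hwm hv hw
  unfold tailE
  have h1 : ∫ q in nd n J, kerf n (v - w) q ∂((volume.restrict Ω).prod (volume.restrict Ω)) ≤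
      ∫ q, kerf n (v - w) q ∂((volume.restrict Ω).prod (volume.restrict Ω)) :=
    setIntegral_le_integral hd (ae_of_all _ fun q => kerf_nonneg _ _ _)
  have h2 : ∫ q in nd n J, kerf n v q ∂((volume.restrict Ω).prod (volume.restrict Ω)) ≤
      ∫ q in nd n J, 2 ^ (n - 1) * (kerf n w q + kerf n (v - w) q)
        ∂((volume.restrict Ω).prod (volume.restrict Ω)) := by
    refine integral_mono hv.integrableOn ((hw.add hd).const_mul _).integrableOn fun q => ?_
    have := kerf_add n w (v - w) q
    rwa [add_sub_cancel] at this
  rw [integral_const_mul, integral_add hw.integrableOn hd.integrableOn] at h2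
  refine h2.trans (mul_le_mul_of_nonneg_left ?_ (by positivity))
  linarith

lemma tailE_tendsto {n : ℕ} (hn : 1 ≤ n) {Ω : Set (Euc n)} {w : Euc n → Euc n}
    (hw : Integrable (kerf n w) ((volume.restrict Ω).prod (volume.restrict Ω))) :
    Tendsto (fun J => tailE n Ω J w) atTop (𝓝 0) := by
  have hanti : Antitone (nd n) := by
    intro a b hab q hq
    have hq' : dist q.1 q.2 ≤ (1 / 2 : ℝ) ^ b := hq
    exact hq'.trans (pow_le_pow_of_le_one (by norm_num) (by norm_num) hab)
  have := tendsto_setIntegral_of_antitone (nd_meas n) hanti ⟨0, hw.integrableOn⟩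
  have h0 : ∫ q in ⋂ J, nd n J, kerf n w q ∂((volume.restrict Ω).prod (volume.restrict Ω)) = 0 := by
    refine setIntegral_eq_zero_of_forall_eq_zero fun q hq => ?_
    have h1 : dist q.1 q.2 ≤ 0 := by
      refine ge_of_tendsto' (tendsto_pow_atTop_nhds_zero_of_lt_one (r := (1 / 2 : ℝ))
        (by norm_num) (by norm_num)) fun J => ?_
      exact Set.mem_iInter.1 hq J
    have h2 : q.1 = q.2 := dist_le_zero.1 h1
    unfold kerf
    rw [h2, sub_self, norm_zero, zero_pow (by omega), zero_div]
  rw [h0] at this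
  exact this

end

open MeasureTheory Metric Filter Topology
noncomputable section

lemma expo_eq {n : ℕ} (hn : 2 ≤ n) :
    (n : ℝ) + ((n : ℝ) - 1) / n * n = ((2 * n - 1 : ℕ) : ℝ) := by
  have : (n : ℝ) ≠ 0 := by positivity
  rw [Nat.cast_sub (by omega)]
  push_cast
  field_simp
  ring

lemma rkerf {n : ℕ} (hn : 2 ≤ n) (v : Euc n → Euc n) (x y : Euc n) :
    ‖v x - v y‖ ^ (n : ℝ) / dist x y ^ ((n : ℝ) + ((n : ℝ) - 1) / n * n) = kerf n v (x, y) := by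
  rw [expo_eq hn, Real.rpow_natCast, Real.rpow_natCast, kerf]

lemma mem_conv {n : ℕ} (hn : 2 ≤ n) {Ω : Set (Euc n)} {u : Euc n → Euc n}
    (hu : MemWsp n (((n : ℝ) - 1) / n) n Ω u) :
    AEStronglyMeasurable u (volume.restrict Ω) ∧ IntegrableOn (fun x => ‖u x‖ ^ n) Ω ∧
    Integrable (kerf n u) ((volume.restrict Ω).prod (volume.restrict Ω)) := by
  obtain ⟨h1, h2, h3⟩ := hu
  refine ⟨h1, ?_, ?_⟩
  · simp only [Real.rpow_natCast] at h2
    exact h2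
  · simpa only [rkerf hn] using h3

lemma rt_tendsto {n : ℕ} (hn : 2 ≤ n) {a : ℕ → ℝ} (ha : ∀ k, 0 ≤ a k)
    (h : Tendsto (fun k => a k ^ (1 / (n : ℝ))) atTop (𝓝 0)) : Tendsto a atTop (𝓝 0) := by
  have h1 := h.pow n
  rw [zero_pow (by omega)] at h1
  refine h1.congr fun k => ?_
  rw [one_div, Real.rpow_inv_natCast_pow (ha k) (by omega)]

lemma sob_conv {n : ℕ} (hn : 2 ≤ n) {Ω : Set (Euc n)} {d : ℕ → Euc n → Euc n}
    (hd : ∀ k, Integrable (kerf n (d k)) ((volume.restrict Ω).prod (volume.restrict Ω)))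
    (h : Tendsto (fun k => sobNorm n (((n : ℝ) - 1) / n) n Ω (d k)) atTop (𝓝 0)) :
    Tendsto (fun k => ∫ x in Ω, ‖d k x‖ ^ n) atTop (𝓝 0) ∧
    Tendsto (fun k => ∫ q, kerf n (d k) q ∂((volume.restrict Ω).prod (volume.restrict Ω)))
      atTop (𝓝 0) := by
  have ha : ∀ k, 0 ≤ ∫ x in Ω, ‖d k x‖ ^ n := fun k => integral_nonneg fun x => by positivity
  have hb : ∀ k, 0 ≤ ∫ q, kerf n (d k) q ∂((volume.restrict Ω).prod (volume.restrict Ω)) :=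
    fun k => integral_nonneg fun q => kerf_nonneg _ _ _
  have he : ∀ k, sobNorm n (((n : ℝ) - 1) / n) n Ω (d k) =
      (∫ x in Ω, ‖d k x‖ ^ n) ^ (1 / (n : ℝ)) +
      (∫ q, kerf n (d k) q ∂((volume.restrict Ω).prod (volume.restrict Ω))) ^ (1 / (n : ℝ)) := by
    intro k
    unfold sobNorm sobSemi
    rw [integral_prod _ (hd k)]
    simp only [rkerf hn]
    simp only [Real.rpow_natCast]
  simp only [he] at h
  refine ⟨rt_tendsto hn ha ?_, rt_tendsto hn hb ?_⟩
  · refine squeeze_zero (fun k => Real.rpow_nonneg (ha k) _) (fun k => ?_) h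
    exact le_add_of_nonneg_right (Real.rpow_nonneg (hb k) _)
  · refine squeeze_zero (fun k => Real.rpow_nonneg (hb k) _) (fun k => ?_) h
    exact le_add_of_nonneg_left (Real.rpow_nonneg (ha k) _)

lemma int_of_pow {n : ℕ} (hn : 2 ≤ n) {Ω : Set (Euc n)} (hb : Bornology.IsBounded Ω)
    {u : Euc n → Euc n} (hm : AEStronglyMeasurable u (volume.restrict Ω))
    (hu : IntegrableOn (fun x => ‖u x‖ ^ n) Ω) : IntegrableOn u Ω := by
  have h1 : IntegrableOn (fun _ : Euc n => (1 : ℝ)) Ω := integrableOn_const hb.measure_lt_top.ne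
  refine (h1.add hu).mono' hm (ae_of_all _ fun x => ?_)
  simp only [Pi.add_apply]
  rcases le_total ‖u x‖ 1 with h | h
  · have : 0 ≤ ‖u x‖ ^ n := by positivity
    linarith
  · have := le_self_pow₀ h (by omega : n ≠ 0)
    linarith

lemma l1_conv {n : ℕ} (hn : 2 ≤ n) {Ω : Set (Euc n)} (hb : Bornology.IsBounded Ω)
    {d : ℕ → Euc n → Euc n} (hm : ∀ k, AEStronglyMeasurable (d k) (volume.restrict Ω))
    (hd : ∀ k, IntegrableOn (fun x => ‖d k x‖ ^ n) Ω)
    (h : Tendsto (fun k => ∫ x in Ω, ‖d k x‖ ^ n) atTop (𝓝 0)) :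
    Tendsto (fun k => ∫ x in Ω, ‖d k x‖) atTop (𝓝 0) := by
  by_cases h0 : volume Ω = 0
  · simp [Measure.restrict_eq_zero.2 h0]
  have h1 : Tendsto (fun k => (∫ x in Ω, ‖d k x‖) ^ n) atTop (𝓝 0) := by
    refine squeeze_zero (fun k => pow_nonneg (integral_nonneg fun x => norm_nonneg _) _)
      (fun k => jensen_pow (by omega) h0 hb.measure_lt_top.ne (fun x => norm_nonneg (d k x))
        (int_of_pow hn hb (hm k) (hd k)).norm (hd k)) ?_
    simpa using h.const_mul (volume.real Ω ^ (n - 1))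
  have h2 := h1.rpow_const (p := 1 / (n : ℝ)) (Or.inr (by positivity))
  rw [Real.zero_rpow (by positivity)] at h2
  refine h2.congr fun k => ?_
  rw [one_div, Real.pow_rpow_inv_natCast (integral_nonneg fun x => norm_nonneg _) (by omega)]

lemma exists_J0 {n : ℕ} {Ω K : Set (Euc n)} (hΩ : IsOpen Ω) (hK : IsCompact K) (hKΩ : K ⊆ Ω) :
    ∃ J₀ : ℕ, ∀ x ∈ K, closedBall x ((1 / 2 : ℝ) ^ J₀) ⊆ Ω := by
  obtain ⟨δ, hδ, hsub⟩ := hK.exists_cthickening_subset_open hΩ hKΩ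
  obtain ⟨J, hJ⟩ := exists_pow_lt_of_lt_one hδ (by norm_num : (1 / 2 : ℝ) < 1)
  refine ⟨J, fun x hx => ?_⟩
  exact (closedBall_subset_closedBall hJ.le).trans
    ((closedBall_subset_cthickening hx δ).trans hsub)

lemma exists_B {n : ℕ} {ψ : Euc n → ℝ} (hψ : ContDiff ℝ 1 ψ) (hψs : HasCompactSupport ψ) :
    ∃ B : ℝ, 0 ≤ B ∧ ∀ x j, |fderiv ℝ ψ x (bv n j)| ≤ B := by
  obtain ⟨B, hB⟩ := (hψ.continuous_fderiv (by norm_num)).bounded_above_of_compact_support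
    (hψs.fderiv (𝕜 := ℝ))
  refine ⟨B, (norm_nonneg _).trans (hB 0), fun x j => ?_⟩
  refine ((fderiv ℝ ψ x).le_opNorm _).trans ?_
  have : ‖bv n j‖ = 1 := by simp [bv]
  rw [this, mul_one]; exact hB x

lemma main_approx
    {n : ℕ} (hn : 2 ≤ n) {Ω : Set (Euc n)} (hΩ : IsOpen Ω)
    (hΩb : Bornology.IsBounded Ω) (hΩs : SmoothBoundary n Ω)
    {u : Euc n → Euc n} (hu : MemWsp n (((n : ℝ) - 1) / n) n Ω u)
    {ψ : Euc n → ℝ} (hψ : Cc1 n Ω ψ) {ε : ℝ} (hε : 0 < ε) :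
    ∃ a : ℝ, ∀ w : ℕ → Euc n → Euc n, (∀ k, ContDiffOn ℝ 1 (w k) (closure Ω)) →
      Tendsto (fun k => sobNorm n (((n : ℝ) - 1) / n) n Ω (w k - u)) atTop (𝓝 0) →
      ∀ᶠ k in atTop, |(∫ x in Ω, (jacMat n (w k) x).det * ψ x) - a| < ε := by
  have : IsFiniteMeasure (volume.restrict Ω) := ⟨by simpa using hΩb.measure_lt_top⟩
  obtain ⟨hum, hun, huk⟩ := mem_conv hn hu
  have hui : IntegrableOn u Ω := int_of_pow hn hΩb hum hun
  obtain ⟨hψ1, hψs, hψΩ⟩ := hψ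
  obtain ⟨M, hM, η, hη⟩ := exists_moll n
  obtain ⟨J₀, hK⟩ := exists_J0 hΩ hψs.isCompact hψΩ
  obtain ⟨B, hB0, hB⟩ := exists_B hψ1 hψs
  obtain ⟨C, hC0, hC⟩ := multi_scale (by omega : 1 ≤ n) hM hη hΩ hΩb hψ1 hψs hB0 hB hK
  set P : ℝ := C * 2 ^ (n - 1) with hP
  have hP0 : 0 ≤ P := by positivity
  have htail : Tendsto (fun J => P * tailE n Ω J u) atTop (𝓝 0) := by
    simpa using (tailE_tendsto (by omega : 1 ≤ n) huk).const_mul P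
  obtain ⟨J, hJ1, hJ2⟩ := (((tendsto_order.1 htail).2 (ε / 3) (by positivity)).and
    (eventually_ge_atTop J₀)).exists
  refine ⟨AJ n Ω ψ (η ((1 / 2 : ℝ) ^ J)) u, fun w hw hlim => ?_⟩
  have hwm : ∀ k, AEStronglyMeasurable (w k) (volume.restrict Ω) := fun k =>
    ((hw k).continuousOn.mono subset_closure).aestronglyMeasurable hΩ.measurableSet
  choose R hR0 hR using fun k => v_bdd hΩb (hw k)
  choose Λ hΛ0 hΛ using fun k => glob_lip hΩ hΩb hΩs (hw k)
  have hwi : ∀ k, IntegrableOn (w k) Ω := fun k =>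
    Integrable.of_bound (hwm k) (R k)
      ((ae_restrict_iff' hΩ.measurableSet).2 (ae_of_all _ (hR k)))
  have hwk : ∀ k, Integrable (kerf n (w k)) ((volume.restrict Ω).prod (volume.restrict Ω)) :=
    fun k => kerf_lip_int hn hΩ hΩb (hwm k) (hΛ k)
  have hwn : ∀ k, IntegrableOn (fun x => ‖w k x - u x‖ ^ n) Ω := by
    intro k
    have h1 : IntegrableOn (fun x => ‖w k x‖ ^ n) Ω := by
      refine Integrable.of_bound ((hwm k).norm.pow n) (R k ^ n)
        ((ae_restrict_iff' hΩ.measurableSet).2 (ae_of_all _ fun x hx => ?_))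
      rw [norm_pow, norm_norm]
      exact pow_le_pow_left₀ (norm_nonneg _) (hR k x hx) n
    refine ((h1.add hun).const_mul (2 ^ (n - 1))).mono' (((hwm k).sub hum).norm.pow n)
      (ae_of_all _ fun x => ?_)
    rw [norm_pow, norm_norm]
    exact (pow_le_pow_left₀ (norm_nonneg _) (norm_sub_le _ _) n).trans
      (add_pow_le (norm_nonneg _) (norm_nonneg _) n)
  have hdk := fun k => kerf_sub_int (hwm k) hum (hwk k) huk
  obtain ⟨hl1, hl2⟩ := sob_conv hn hdk hlim
  have hL1 : Tendsto (fun k => ∫ x in Ω, ‖w k x - u x‖) atTop (𝓝 0) :=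
    l1_conv hn hΩb (d := fun k => w k - u) (fun k => (hwm k).sub hum) hwn hl1
  have hstab := AJ_stable hM (by positivity : (0 : ℝ) < (1 / 2) ^ J) (hη _ (by positivity)) hΩ
    hψ1.continuous hψs hui hwi hL1
  have hlk : Tendsto (fun k => P * ∫ q, kerf n (w k - u) q
      ∂((volume.restrict Ω).prod (volume.restrict Ω))) atTop (𝓝 0) := by
    simpa using hl2.const_mul P
  filter_upwards [(tendsto_order.1 hlk).2 (ε / 3) (by positivity),
    (Metric.tendsto_nhds.1 hstab) (ε / 3) (by positivity)] with k hk1 hk2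
  have hd : ∀ x ∈ Ω, DifferentiableAt ℝ (w k) x := fun x hx =>
    ((hw k).contDiffAt (mem_of_superset (hΩ.mem_nhds hx) subset_closure)).differentiableAt
      (by norm_num)
  have hA := AJ_limit hM hη hΩ hψ1.continuous hψs hK (hwi k) hd (hΛ0 k) (hΛ k)
  have hA2 : |(∫ x in Ω, (jacMat n (w k) x).det * ψ x) -
      AJ n Ω ψ (η ((1 / 2 : ℝ) ^ J)) (w k)| ≤ C * tailE n Ω J (w k) := by
    have h1 := (hA.comp (tendsto_add_atTop_nat J)).sub_const
      (AJ n Ω ψ (η ((1 / 2 : ℝ) ^ J)) (w k))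
    refine le_of_tendsto' h1.abs fun m => ?_
    have := hC (w k) (R k) (hwm k) (hR k) (hwk k) J hJ2 m
    simp only [Function.comp_apply, add_comm m J]
    exact this
  have hT := mul_le_mul_of_nonneg_left (tailE_le (hwm k) hum (hwk k) huk J) hC0
  rw [Real.dist_eq] at hk2
  have h3 := abs_sub_le (∫ x in Ω, (jacMat n (w k) x).det * ψ x)
    (AJ n Ω ψ (η ((1 / 2 : ℝ) ^ J)) (w k)) (AJ n Ω ψ (η ((1 / 2 : ℝ) ^ J)) u)
  rw [← mul_assoc, ← hP, mul_add] at hT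
  linarith

lemma concl {a b : ℕ → ℝ}
    (h : ∀ ε > 0, ∃ c : ℝ, (∀ᶠ k in atTop, |a k - c| < ε) ∧ ∀ᶠ k in atTop, |b k - c| < ε) :
    ∃ L, Tendsto a atTop (𝓝 L) ∧ Tendsto b atTop (𝓝 L) := by
  have hc : CauchySeq a := by
    rw [Metric.cauchySeq_iff']
    intro ε hε
    obtain ⟨c, hc, -⟩ := h (ε / 2) (by positivity)
    obtain ⟨N, hN⟩ := eventually_atTop.1 hc
    refine ⟨N, fun k hk => ?_⟩
    have h1 := hN k hk
    have h2 := hN N le_rfl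
    rw [← Real.dist_eq] at h1 h2
    have := dist_triangle_right (a k) (a N) c
    linarith
  obtain ⟨L, hL⟩ := cauchySeq_tendsto_of_complete hc
  refine ⟨L, hL, Metric.tendsto_nhds.2 fun ε hε => ?_⟩
  obtain ⟨c, hc1, hc2⟩ := h (ε / 3) (by positivity)
  obtain ⟨k0, hk1, hk2⟩ := (hc1.and (Metric.tendsto_nhds.1 hL (ε / 3) (by positivity))).exists
  filter_upwards [hc2] with k hk
  rw [← Real.dist_eq] at hk hk1
  have h1 := dist_triangle (b k) c L
  have h2 := dist_triangle_left c L (a k0)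
  linarith

end

/-- The distributional Jacobian `⟨Ju, ψ⟩` of `u ∈ W^{(n-1)/n,n}(Ω; ℝⁿ)` is
well defined: any two smooth approximating sequences give the same limit. -/
theorem jacobian_well_defined
    (n : ℕ) (hn : 2 ≤ n) (Ω : Set (Euc n)) (hΩo : IsOpen Ω)
    (hΩb : Bornology.IsBounded Ω) (hΩs : SmoothBoundary n Ω)
    (u : Euc n → Euc n) (hu : MemWsp n (((n : ℝ) - 1) / n) n Ω u)
    (ψ : Euc n → ℝ) (hψ : Cc1 n Ω ψ)
    (uk vk : ℕ → Euc n → Euc n)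
    (huk : ∀ k, ContDiffOn ℝ 1 (uk k) (closure Ω))
    (hvk : ∀ k, ContDiffOn ℝ 1 (vk k) (closure Ω))
    (huku : Tendsto (fun k => sobNorm n (((n : ℝ) - 1) / n) n Ω (uk k - u)) atTop (𝓝 0))
    (hvku : Tendsto (fun k => sobNorm n (((n : ℝ) - 1) / n) n Ω (vk k - u)) atTop (𝓝 0)) :
    ∃ L : ℝ,
      Tendsto (fun k => ∫ x in Ω, (jacMat n (uk k) x).det * ψ x) atTop (𝓝 L) ∧
      Tendsto (fun k => ∫ x in Ω, (jacMat n (vk k) x).det * ψ x) atTop (𝓝 L) := by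
  refine concl fun ε hε => ?_
  obtain ⟨c, hc⟩ := main_approx hn hΩo hΩb hΩs hu hψ hε
  exact ⟨c, hc uk huk huku, hc vk hvk hvku⟩

end
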